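/- arXiv:1211.5115 — 2 statements merged into one kernel-verified Lean document; each statement's English description precedes it below -/
import Mathlib

section
/- There exist 2^n dyadic grids 𝒟_1,…,𝒟_{2^n} in ℝ^n such that for every cube Q ⊂ ℝ^n there exist α ∈ {1,…,2^n} and a cube Q_α ∈ 𝒟_α with Q ⊂ Q_α and ℓ_{Q_α} ≤ 6 ℓ_Q, where ℓ_Q denotes the sidelength of Q. -/
open MeasureTheory
open scoped ENNReal NNReal BigOperators

noncomputable section

/-- An axis-parallel (half-open) cube in `ℝⁿ`, described by its lower-left corner and its
(positive) side length. -/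
structure Cube (n : ℕ) where
  corner : Fin n → ℝ
  side : ℝ
  side_pos : 0 < side

namespace Cube

variable {n : ℕ}

/-- The set of points of a cube. -/
def toSet (Q : Cube n) : Set (Fin n → ℝ) :=
  {x | ∀ i, Q.corner i ≤ x i ∧ x i < Q.corner i + Q.side}

/-- The cube concentric with `Q` whose side length is `c ℓ_Q` (`c > 0`). -/
def dilate (Q : Cube n) (c : ℝ) (hc : 0 < c) : Cube n :=
  ⟨fun i => Q.corner i + Q.side / 2 - c * Q.side / 2, c * Q.side, mul_pos hc Q.side_pos⟩

end Cube

variable {n m : ℕ}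

/-- The average `(1/|Q|) ∫_Q |f|`, as an extended nonnegative real. -/
def cubeAvg (Q : Cube n) (f : (Fin n → ℝ) → ℝ) : ℝ≥0∞ :=
  (∫⁻ x in Q.toSet, ENNReal.ofReal |f x|) / volume Q.toSet

/-- The average `(1/|Q|) ∫_Q f`, as a real number. -/
def cubeAvgR (Q : Cube n) (f : (Fin n → ℝ) → ℝ) : ℝ :=
  (∫ x in Q.toSet, f x) / (volume Q.toSet).toReal

/-- The multi(sub)linear maximal operator `M(f⃗)`. -/
def multiMax (f : Fin m → (Fin n → ℝ) → ℝ) (x : Fin n → ℝ) : ℝ≥0∞ :=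
  ⨆ (Q : Cube n) (_ : x ∈ Q.toSet), ∏ i, cubeAvg Q (f i)

/-- The multilinear maximal operator restricted to a family `D` of cubes. -/
def multiMaxD (D : Set (Cube n)) (f : Fin m → (Fin n → ℝ) → ℝ) (x : Fin n → ℝ) : ℝ≥0∞ :=
  ⨆ (Q : Cube n) (_ : Q ∈ D) (_ : x ∈ Q.toSet), ∏ i, cubeAvg Q (f i)

/-- The Hardy–Littlewood maximal operator. -/
def hlMax (f : (Fin n → ℝ) → ℝ) (x : Fin n → ℝ) : ℝ≥0∞ :=
  ⨆ (Q : Cube n) (_ : x ∈ Q.toSet), cubeAvg Q f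

/-- The Fujii–Wilson `A_∞` constant `sup_Q (1/w(Q)) ∫_Q M(w χ_Q)`. -/
def AinftyConst (w : (Fin n → ℝ) → ℝ) : ℝ≥0∞ :=
  ⨆ Q : Cube n,
    (∫⁻ x in Q.toSet, hlMax (Q.toSet.indicator w) x) /
      ∫⁻ x in Q.toSet, ENNReal.ofReal (w x)

/-- The Muckenhoupt `A_q` constant of a weight. -/
def AqConst (q : ℝ) (w : (Fin n → ℝ) → ℝ) : ℝ≥0∞ :=
  ⨆ Q : Cube n, cubeAvg Q w * (cubeAvg Q fun x => w x ^ (-(q - 1)⁻¹)) ^ (q - 1)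

/-- The exponent `p` determined by `1/p = Σ 1/p_i`. -/
def pHarm (p : Fin m → ℝ) : ℝ := (∑ i, (p i)⁻¹)⁻¹

/-- The weight `ν_{w⃗} = ∏ w_i^{p/p_i}`. -/
def nuWeight (p : Fin m → ℝ) (w : Fin m → (Fin n → ℝ) → ℝ) : (Fin n → ℝ) → ℝ :=
  fun x => ∏ i, w i x ^ (pHarm p / p i)

/-- The dual weight `σ_i = w_i^{1 - p_i'}`, where `p_i' = p_i/(p_i - 1)`. -/
def sigmaWeight (p : Fin m → ℝ) (w : Fin m → (Fin n → ℝ) → ℝ) (i : Fin m) :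
    (Fin n → ℝ) → ℝ :=
  fun x => w i x ^ (1 - p i / (p i - 1))

/-- The multilinear Muckenhoupt constant `[w⃗]_{A_{P⃗}}`; the exponent `p/p_i'` is written
as `p (1 - 1/p_i)`. -/
def APConst (p : Fin m → ℝ) (w : Fin m → (Fin n → ℝ) → ℝ) : ℝ≥0∞ :=
  ⨆ Q : Cube n,
    cubeAvg Q (nuWeight p w) *
      ∏ i, cubeAvg Q (sigmaWeight p w i) ^ (pHarm p * (1 - (p i)⁻¹))

/-- The weighted Lebesgue norm `(∫ |f|^q w)^{1/q}`. -/
def weightedNorm (q : ℝ) (w f : (Fin n → ℝ) → ℝ) : ℝ≥0∞ :=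
  (∫⁻ x, ENNReal.ofReal |f x| ^ q * ENNReal.ofReal (w x)) ^ q⁻¹

/-- The weighted Lebesgue norm of an `ℝ≥0∞`-valued function. -/
def weightedNormE (q : ℝ) (w : (Fin n → ℝ) → ℝ) (g : (Fin n → ℝ) → ℝ≥0∞) : ℝ≥0∞ :=
  (∫⁻ x, g x ^ q * ENNReal.ofReal (w x)) ^ q⁻¹

/-- The (unweighted) Lebesgue norm of an `ℝ≥0∞`-valued function. -/
def lnormE (q : ℝ) (g : (Fin n → ℝ) → ℝ≥0∞) : ℝ≥0∞ :=
  (∫⁻ x, g x ^ q) ^ q⁻¹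

/-- The (unweighted) Lebesgue norm of a real-valued function. -/
def lpnorm (q : ℝ) (f : (Fin n → ℝ) → ℝ) : ℝ≥0∞ :=
  lnormE q fun x => ENNReal.ofReal |f x|

/-- A general dyadic grid: every cube has side length `2^k` for some `k : ℤ`; any two cubes
are nested or disjoint; for each fixed `k` the cubes of side length `2^k` partition `ℝⁿ`. -/
def IsDyadicGrid (D : Set (Cube n)) : Prop :=
  (∀ Q ∈ D, ∃ k : ℤ, Q.side = (2 : ℝ) ^ k) ∧
    (∀ Q ∈ D, ∀ R ∈ D,
      Q.toSet ∩ R.toSet = Q.toSet ∨ Q.toSet ∩ R.toSet = R.toSet ∨ Q.toSet ∩ R.toSet = ∅) ∧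
    ∀ (k : ℤ) (x : Fin n → ℝ), ∃! Q : Cube n, Q ∈ D ∧ Q.side = (2 : ℝ) ^ k ∧ x ∈ Q.toSet

/-- The standard dyadic grid `{2^{-k}([0,1)^n + j) : k ∈ ℤ, j ∈ ℤⁿ}`. -/
def stdGrid (n : ℕ) : Set (Cube n) :=
  {Q | ∃ (k : ℤ) (j : Fin n → ℤ),
    Q.side = (2 : ℝ) ^ k ∧ ∀ i, Q.corner i = (2 : ℝ) ^ k * (j i : ℝ)}

/-- The family `𝒟(Q₀)` of dyadic subcubes of a cube `Q₀`. -/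
def dyadicSub (Q₀ : Cube n) : Set (Cube n) :=
  {Q | ∃ (k : ℕ) (j : Fin n → ℕ), (∀ i, j i < 2 ^ k) ∧ Q.side = Q₀.side / 2 ^ k ∧
    ∀ i, Q.corner i = Q₀.corner i + (j i : ℝ) * (Q₀.side / 2 ^ k)}

/-- A sparse family of cubes `{Q_j^k}`: for each `k` the cubes are pairwise disjoint, the
sets `Ω_k = ∪_j Q_j^k` are nested, and `|Ω_{k+1} ∩ Q_j^k| ≤ |Q_j^k|/2`. -/
structure SparseFamily (n : ℕ) where
  cubes : ℤ → Set (Cube n)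
  pairwiseDisjoint : ∀ k, (cubes k).PairwiseDisjoint Cube.toSet
  nested : ∀ k : ℤ, (⋃ Q ∈ cubes (k + 1), Q.toSet) ⊆ ⋃ Q ∈ cubes k, Q.toSet
  sparse : ∀ k : ℤ, ∀ Q ∈ cubes k,
    volume ((⋃ R ∈ cubes (k + 1), R.toSet) ∩ Q.toSet) ≤ volume Q.toSet / 2

/-- The multilinear sparse operator `𝒜_{𝒟,𝒮}(f⃗) = Σ_{j,k} (∏ (f_i)_{Q_j^k}) χ_{Q_j^k}`. -/
def sparseOp (S : SparseFamily n) (f : Fin m → (Fin n → ℝ) → ℝ) (x : Fin n → ℝ) : ℝ≥0∞ :=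
  ∑' (k : ℤ) (Q : S.cubes k),
    Q.1.toSet.indicator (fun _ => ∏ i, cubeAvg Q.1 (f i)) x

/-- The dilated sparse operator `𝒯_{𝒮,l}(f⃗) = Σ_{j,k} (∏ (f_i)_{2^l Q_j^k}) χ_{Q_j^k}`. -/
def sparseOpDil (S : SparseFamily n) (l : ℕ) (f : Fin m → (Fin n → ℝ) → ℝ)
    (x : Fin n → ℝ) : ℝ≥0∞ :=
  ∑' (k : ℤ) (Q : S.cubes k),
    Q.1.toSet.indicator
      (fun _ => ∏ i, cubeAvg (Q.1.dilate ((2 : ℝ) ^ l) (by positivity)) (f i)) x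

/-- The non-increasing rearrangement `f^*(t) = inf {α > 0 : |{|f| > α}| < t}`. -/
def rearr (f : (Fin n → ℝ) → ℝ) (t : ℝ≥0∞) : ℝ≥0∞ :=
  sInf (ENNReal.ofReal '' {α : ℝ | 0 < α ∧ volume {x | α < |f x|} < t})

/-- The local mean oscillation `ω_λ(f;Q) = inf_c ((f - c)χ_Q)^*(λ|Q|)`. -/
def osc (lam : ℝ) (f : (Fin n → ℝ) → ℝ) (Q : Cube n) : ℝ≥0∞ :=
  ⨅ c : ℝ, rearr (Q.toSet.indicator fun x => f x - c) (ENNReal.ofReal lam * volume Q.toSet)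

/-- The dyadic local sharp maximal function `m^{#,d}_{λ;Q₀} f`. -/
def locSharpMax (lam : ℝ) (Q₀ : Cube n) (f : (Fin n → ℝ) → ℝ) (x : Fin n → ℝ) : ℝ≥0∞ :=
  ⨆ (Q : Cube n) (_ : Q ∈ dyadicSub Q₀) (_ : x ∈ Q.toSet), osc lam f Q

/-- `c` is a median value of `f` over the cube `Q`. -/
def IsMedian (f : (Fin n → ℝ) → ℝ) (Q : Cube n) (c : ℝ) : Prop :=
  volume {x ∈ Q.toSet | c < f x} ≤ volume Q.toSet / 2 ∧
    volume {x ∈ Q.toSet | f x < c} ≤ volume Q.toSet / 2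

/-- A Banach function space over `ℝⁿ` with Lebesgue measure, described (Bennett–Sharpley
style) through its function norm `ρ`, which is defined for all `ℝ≥0∞`-valued functions:
`ρ` is a norm with the lattice and Fatou properties, finite on indicators of sets of finite
measure and controlling the integral over sets of finite measure. -/
structure BFunctionSpace (n : ℕ) where
  ρ : ((Fin n → ℝ) → ℝ≥0∞) → ℝ≥0∞
  congr : ∀ f g, f =ᵐ[volume] g → ρ f = ρ g
  eq_zero_iff : ∀ f, (ρ f = 0 ↔ f =ᵐ[volume] 0)
  add_le : ∀ f g, ρ (fun x => f x + g x) ≤ ρ f + ρ g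
  smul_eq : ∀ (c : ℝ≥0) (f), ρ (fun x => (c : ℝ≥0∞) * f x) = (c : ℝ≥0∞) * ρ f
  mono : ∀ f g, (∀ᵐ x ∂volume, f x ≤ g x) → ρ f ≤ ρ g
  fatou : ∀ f : ℕ → (Fin n → ℝ) → ℝ≥0∞, (∀ k x, f k x ≤ f (k + 1) x) →
    ρ (fun x => ⨆ k, f k x) = ⨆ k, ρ (f k)
  indicator_lt_top : ∀ E : Set (Fin n → ℝ), MeasurableSet E → volume E < ∞ →
    ρ (E.indicator fun _ => (1 : ℝ≥0∞)) < ∞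
  lintegral_le : ∀ E : Set (Fin n → ℝ), MeasurableSet E → volume E < ∞ →
    ∃ C : ℝ≥0∞, C < ∞ ∧ ∀ f, ∫⁻ x in E, f x ≤ C * ρ f

/-- The norm in `X` of a real-valued function. -/
def BFunctionSpace.normR (X : BFunctionSpace n) (f : (Fin n → ℝ) → ℝ) : ℝ≥0∞ :=
  X.ρ fun x => ENNReal.ofReal |f x|

/-- The associate function norm `ρ'(g) = sup {∫ f g : ρ(f) ≤ 1}`. -/
def assocNorm (ρ : ((Fin n → ℝ) → ℝ≥0∞) → ℝ≥0∞) (g : (Fin n → ℝ) → ℝ≥0∞) : ℝ≥0∞ :=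
  ⨆ (f : (Fin n → ℝ) → ℝ≥0∞) (_ : ρ f ≤ 1), ∫⁻ x, f x * g x

/-- The `X`-average over a cube: `‖f‖_{X,Q} = ‖τ_{ℓ_Q}(f χ_Q)‖_X`, where `τ_δ f(x) = f(δx)`. -/
def normAvg (ρ : ((Fin n → ℝ) → ℝ≥0∞) → ℝ≥0∞) (Q : Cube n)
    (f : (Fin n → ℝ) → ℝ≥0∞) : ℝ≥0∞ :=
  ρ fun x => Q.toSet.indicator f (Q.side • x)

/-- The maximal operator `M_X f(x) = sup_{Q ∋ x} ‖f‖_{X,Q}` associated to a function norm. -/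
def maxOpNorm (ρ : ((Fin n → ℝ) → ℝ≥0∞) → ℝ≥0∞) (f : (Fin n → ℝ) → ℝ≥0∞)
    (x : Fin n → ℝ) : ℝ≥0∞ :=
  ⨆ (Q : Cube n) (_ : x ∈ Q.toSet), normAvg ρ Q f

/-- A bounded, compactly supported, measurable function. -/
def Admissible (g : (Fin n → ℝ) → ℝ) : Prop :=
  Measurable g ∧ (∃ M : ℝ, ∀ x, |g x| ≤ M) ∧ HasCompactSupport g

/-- An `m`-linear Calderón–Zygmund operator on `ℝⁿ`: a multilinear operator bounded from
`L^{q_1} × ⋯ × L^{q_m}` to `L^q` (`1/q = Σ 1/q_i`), with a kernel representation away from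
the support, the kernel satisfying the standard size and `ε`-smoothness estimates off the
diagonal. -/
structure MultilinearCZO (n m : ℕ) where
  T : (Fin m → (Fin n → ℝ) → ℝ) → (Fin n → ℝ) → ℝ
  K : (Fin (m + 1) → Fin n → ℝ) → ℝ
  A : ℝ
  A_pos : 0 < A
  ε : ℝ
  ε_pos : 0 < ε
  q : Fin m → ℝ
  one_le_q : ∀ j, 1 ≤ q j
  C₀ : ℝ
  C₀_pos : 0 < C₀
  norm_le : ∀ f : Fin m → (Fin n → ℝ) → ℝ, (∀ i, Measurable (f i)) →
    lpnorm (∑ i, (q i)⁻¹)⁻¹ (T f) ≤ ENNReal.ofReal C₀ * ∏ i, lpnorm (q i) (f i)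
  map_add : ∀ (f : Fin m → (Fin n → ℝ) → ℝ) (i : Fin m) (g₁ g₂ : (Fin n → ℝ) → ℝ),
    (∀ j, Admissible (f j)) → Admissible g₁ → Admissible g₂ →
    T (Function.update f i fun x => g₁ x + g₂ x) =
      fun x => T (Function.update f i g₁) x + T (Function.update f i g₂) x
  map_smul : ∀ (f : Fin m → (Fin n → ℝ) → ℝ) (i : Fin m) (c : ℝ) (g : (Fin n → ℝ) → ℝ),
    (∀ j, Admissible (f j)) → Admissible g →
    T (Function.update f i fun x => c * g x) = fun x => c * T (Function.update f i g) x
  kernel_repr : ∀ f : Fin m → (Fin n → ℝ) → ℝ, (∀ i, Admissible (f i)) →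
    ∀ x, x ∉ ⋂ i, tsupport (f i) →
      T f x = ∫ y : Fin m → Fin n → ℝ, K (Fin.cons x y) * ∏ i, f i (y i)
  size : ∀ y : Fin (m + 1) → Fin n → ℝ, (¬ ∀ k l, y k = y l) →
    |K y| ≤ A / (∑ k, ∑ l, ‖y k - y l‖) ^ ((m * n : ℕ) : ℝ)
  smooth : ∀ (y : Fin (m + 1) → Fin n → ℝ) (j : Fin (m + 1)) (y' : Fin n → ℝ),
    (¬ ∀ k l, y k = y l) →
    (¬ ∀ k l, Function.update y j y' k = Function.update y j y' l) →
    ‖y j - y'‖ ≤ (1 / 2) * ⨆ k, ‖y j - y k‖ →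
    |K y - K (Function.update y j y')| ≤
      A * ‖y j - y'‖ ^ ε / (∑ k, ∑ l, ‖y k - y l‖) ^ (((m * n : ℕ) : ℝ) + ε)


/-- Boundary points of the one-dimensional grid number `t` at level `k`. -/
def bdry (t : Fin 2) (k j : ℤ) : ℝ := (2 : ℝ) ^ k * ((j : ℝ) + ((t : ℕ) : ℝ) * ((-1 : ℝ) ^ k / 3))

lemma bdry_succ (t : Fin 2) (k j : ℤ) : bdry t k (j + 1) = bdry t k j + (2 : ℝ) ^ k := by
  unfold bdry; push_cast; ring

lemma bdry_lt_iff (t : Fin 2) (k j j' : ℤ) : bdry t k j < bdry t k j' ↔ j < j' := by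
  have h : (0 : ℝ) < (2 : ℝ) ^ k := by positivity
  unfold bdry
  rw [mul_lt_mul_iff_right₀ h, add_lt_add_iff_right, Int.cast_lt]

lemma bdry_le_iff (t : Fin 2) (k j j' : ℤ) : bdry t k j ≤ bdry t k j' ↔ j ≤ j' := by
  rw [← not_lt, bdry_lt_iff, not_lt]

lemma neg_one_zpow_cases (k : ℤ) : (-1 : ℝ) ^ k = 1 ∨ (-1 : ℝ) ^ k = -1 := by
  rcases Int.even_or_odd k with h | h
  · exact Or.inl h.neg_one_zpow
  · exact Or.inr h.neg_one_zpow

lemma bdry_step (t : Fin 2) (l j : ℤ) : ∃ j', bdry t (l + 1) j = bdry t l j' := by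
  unfold bdry
  rw [zpow_add_one₀ (by norm_num), zpow_add_one₀ (by norm_num)]
  rcases neg_one_zpow_cases l with h | h <;> rw [h]
  · exact ⟨2 * j - (t : ℕ), by push_cast; ring⟩
  · exact ⟨2 * j + (t : ℕ), by push_cast; ring⟩

lemma bdry_nested (t : Fin 2) (k l : ℤ) (h : k ≤ l) : ∀ j, ∃ j', bdry t l j = bdry t k j' := by
  induction l, h using Int.leInduction with
  | base => exact fun j => ⟨j, rfl⟩
  | succ l _ ih =>
    intro j
    obtain ⟨j', hj'⟩ := bdry_step t l j
    obtain ⟨j'', hj''⟩ := ih j'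
    exact ⟨j'', hj'.trans hj''⟩

lemma bdry_cover (a s : ℝ) (k : ℤ) (h : 3 * s ≤ (2 : ℝ) ^ k) :
    ∃ (t : Fin 2) (j : ℤ), bdry t k j ≤ a ∧ a + s ≤ bdry t k j + (2 : ℝ) ^ k := by
  have hp : (0 : ℝ) < (2 : ℝ) ^ k := by positivity
  obtain ⟨u, rfl⟩ : ∃ u, a = (2 : ℝ) ^ k * u := ⟨a / 2 ^ k, by field_simp⟩
  obtain ⟨v, rfl⟩ : ∃ v, s = (2 : ℝ) ^ k * v := ⟨s / 2 ^ k, by field_simp⟩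
  have hv : 3 * v ≤ 1 := by
    by_contra hc
    push Not at hc
    nlinarith
  have key : ∃ (t : Fin 2) (j : ℤ), (j : ℝ) + ((t : ℕ) : ℝ) * ((-1 : ℝ) ^ k / 3) ≤ u ∧
      u + v ≤ (j : ℝ) + ((t : ℕ) : ℝ) * ((-1 : ℝ) ^ k / 3) + 1 := by
    have h1 := Int.floor_le u
    have h2 := Int.lt_floor_add_one u
    by_cases hc : u + v ≤ (⌊u⌋ : ℝ) + 1
    · exact ⟨0, ⌊u⌋, by simpa using h1, by simpa using hc⟩
    · push Not at hc
      rcases neg_one_zpow_cases k with e | e <;> rw [e]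
      · refine ⟨1, ⌊u⌋, ?_, ?_⟩ <;> norm_num <;> linarith
      · refine ⟨1, ⌊u⌋ + 1, ?_, ?_⟩ <;> norm_num <;> linarith
  obtain ⟨t, j, h1, h2⟩ := key
  refine ⟨t, j, mul_le_mul_of_nonneg_left h1 hp.le, ?_⟩
  have := mul_le_mul_of_nonneg_left h2 hp.le
  unfold bdry
  linarith

/-- The shifted dyadic grid with shift pattern `t`. -/
def shiftedGrid {n : ℕ} (t : Fin n → Fin 2) : Set (Cube n) :=
  {Q | ∃ (k : ℤ) (j : Fin n → ℤ), Q.side = (2 : ℝ) ^ k ∧ ∀ i, Q.corner i = bdry (t i) k (j i)}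

lemma shiftedGrid_nested {n : ℕ} (t : Fin n → Fin 2) (Q R : Cube n) (k l : ℤ) (hkl : k ≤ l)
    (j j' : Fin n → ℤ) (hQ : Q.side = (2 : ℝ) ^ k) (hQc : ∀ i, Q.corner i = bdry (t i) k (j i))
    (hR : R.side = (2 : ℝ) ^ l) (hRc : ∀ i, R.corner i = bdry (t i) l (j' i))
    (x : Fin n → ℝ) (hxQ : x ∈ Q.toSet) (hxR : x ∈ R.toSet) : Q.toSet ⊆ R.toSet := by
  intro y hy i
  obtain ⟨a1, a2⟩ := hxQ i
  obtain ⟨b1, b2⟩ := hxR i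
  obtain ⟨c1, c2⟩ := hy i
  rw [hQc, hQ, ← bdry_succ] at *
  rw [hRc, hR, ← bdry_succ] at *
  obtain ⟨p, hp⟩ := bdry_nested (t i) k l hkl (j' i)
  obtain ⟨q, hq⟩ := bdry_nested (t i) k l hkl (j' i + 1)
  have h1 : p < j i + 1 := (bdry_lt_iff (t i) k _ _).1 (by linarith)
  have h2 : j i < q := (bdry_lt_iff (t i) k _ _).1 (by linarith)
  have h3 := (bdry_le_iff (t i) k p (j i)).2 (by omega)
  have h4 := (bdry_le_iff (t i) k (j i + 1) q).2 (by omega)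
  constructor <;> linarith

lemma shiftedGrid_isDyadicGrid {n : ℕ} (t : Fin n → Fin 2) : IsDyadicGrid (shiftedGrid t) := by
  refine ⟨fun Q ⟨k, _, h, _⟩ => ⟨k, h⟩, ?_, ?_⟩
  · rintro Q ⟨k, j, hQ, hQc⟩ R ⟨l, j', hR, hRc⟩
    rcases Set.eq_empty_or_nonempty (Q.toSet ∩ R.toSet) with h | ⟨x, hxQ, hxR⟩
    · exact Or.inr (Or.inr h)
    rcases le_total k l with h | h
    · exact Or.inl (Set.inter_eq_left.2
        (shiftedGrid_nested t Q R k l h j j' hQ hQc hR hRc x hxQ hxR))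
    · exact Or.inr (Or.inl (Set.inter_eq_right.2
        (shiftedGrid_nested t R Q l k h j' j hR hRc hQ hQc x hxR hxQ)))
  · intro k x
    have hp : (0 : ℝ) < (2 : ℝ) ^ k := by positivity
    have hex : ∀ i, ∃ j : ℤ, bdry (t i) k j ≤ x i ∧ x i < bdry (t i) k j + (2 : ℝ) ^ k := by
      intro i
      set θ : ℝ := ((t i : ℕ) : ℝ) * ((-1 : ℝ) ^ k / 3) with hθ
      have h1 := mul_le_mul_of_nonneg_left (Int.floor_le (x i / 2 ^ k - θ)) hp.le
      have h2 := mul_lt_mul_of_pos_left (Int.lt_floor_add_one (x i / 2 ^ k - θ)) hp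
      have h3 : (2 : ℝ) ^ k * (x i / 2 ^ k) = x i := by field_simp
      refine ⟨⌊x i / 2 ^ k - θ⌋, ?_, ?_⟩ <;> unfold bdry <;> rw [← hθ] <;> linarith
    choose j hj using hex
    refine ⟨⟨fun i => bdry (t i) k (j i), (2 : ℝ) ^ k, hp⟩,
      ⟨⟨k, j, rfl, fun i => rfl⟩, rfl, hj⟩, ?_⟩
    rintro ⟨c, s, hs⟩ ⟨⟨l, j', hl, hc⟩, hk, hx⟩
    simp only at hl hc hk
    subst hk
    obtain rfl : k = l := zpow_right_injective₀ (by norm_num) (by norm_num) hl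
    congr 1
    funext i
    rw [hc i]
    obtain ⟨h1, h2⟩ := hx i
    obtain ⟨h3, h4⟩ := hj i
    simp only at h1 h2
    rw [hc i] at h1 h2
    rw [← bdry_succ] at h2 h4
    have h5 := (bdry_lt_iff (t i) k (j' i) (j i + 1)).1 (by linarith)
    have h6 := (bdry_lt_iff (t i) k (j i) (j' i + 1)).1 (by linarith)
    have : j' i = j i := by omega
    rw [this]

/-- Proposition 2.1: there are `2^n` dyadic grids `𝒟_α` such that every
cube `Q ⊂ ℝⁿ` is contained in a cube `Q_α ∈ 𝒟_α` with `ℓ_{Q_α} ≤ 6 ℓ_Q`. -/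
theorem exists_shifted_dyadic_grids (n : ℕ) :
    ∃ D : Fin (2 ^ n) → Set (Cube n),
      (∀ α, IsDyadicGrid (D α)) ∧
      ∀ Q : Cube n, ∃ (α : Fin (2 ^ n)) (Qα : Cube n),
        Qα ∈ D α ∧ Q.toSet ⊆ Qα.toSet ∧ Qα.side ≤ 6 * Q.side := by
  refine ⟨fun α => shiftedGrid (finFunctionFinEquiv.symm α),
    fun α => shiftedGrid_isDyadicGrid _, fun Q => ?_⟩
  have hQ := Q.side_pos
  obtain ⟨k, hk1, hk2⟩ := exists_mem_Ioc_zpow (x := 3 * Q.side) (y := (2 : ℝ))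
    (by linarith) (by norm_num)
  choose t j h1 h2 using fun i => bdry_cover (Q.corner i) Q.side (k + 1) hk2
  refine ⟨finFunctionFinEquiv t,
    ⟨fun i => bdry (t i) (k + 1) (j i), (2 : ℝ) ^ (k + 1), by positivity⟩,
    ⟨k + 1, j, rfl, fun i => by simp⟩, ?_, ?_⟩
  · intro x hx i
    obtain ⟨a, b⟩ := hx i
    exact ⟨(h1 i).trans a, b.trans_le (h2 i)⟩
  · simp only
    rw [zpow_add_one₀ (by norm_num)]
    linarith
end
end

section
/- Dilated sparse operators are dominated by sparse operators in norm: let l ≥ 0 be an integer. There is a constant c = c(m,n) such that for every Banach function space X over ℝ^n and all nonnegative integrable f_1,…,f_m, sup_{𝒮} ‖𝒯_{𝒮,l}(f⃗)‖_X ≤ c (l+1) sup_{𝒟,𝒮} ‖𝒜_{𝒟,𝒮}(f⃗)‖_X, where the left supremum is over all sparse families 𝒮 in the standard dyadic grid and the right supremum is over all dyadic grids 𝒟 and sparse families 𝒮 ⊂ 𝒟. -/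
open MeasureTheory
open scoped ENNReal NNReal BigOperators

noncomputable section

variable {n m : ℕ}

namespace DSD

open Set

/-! ### Cubes -/

lemma toSet_eq_pi {n : ℕ} (Q : Cube n) :
    Q.toSet = Set.pi univ fun i => Set.Ico (Q.corner i) (Q.corner i + Q.side) := by
  ext x
  simp [Cube.toSet, Set.mem_pi]

lemma measurableSet_toSet {n : ℕ} (Q : Cube n) : MeasurableSet Q.toSet := by
  rw [toSet_eq_pi]
  exact MeasurableSet.univ_pi fun i => measurableSet_Ico

lemma volume_toSet {n : ℕ} (Q : Cube n) : volume Q.toSet = ENNReal.ofReal Q.side ^ n := by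
  rw [toSet_eq_pi, Real.volume_pi_Ico]
  simp

lemma volume_ne_zero {n : ℕ} (Q : Cube n) : volume Q.toSet ≠ 0 := by
  rw [volume_toSet]
  exact pow_ne_zero _ (by simpa using Q.side_pos)

lemma volume_ne_top {n : ℕ} (Q : Cube n) : volume Q.toSet ≠ ∞ := by
  rw [volume_toSet]
  exact ENNReal.pow_ne_top ENNReal.ofReal_ne_top

lemma two_zpow_inj {a b : ℤ} (h : (2 : ℝ) ^ a = 2 ^ b) : a = b :=
  zpow_right_injective₀ (by norm_num) (by norm_num) h

/-- An abstract dyadic grid with its point-to-cube maps. -/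
structure Gr (n : ℕ) where
  q : ℤ → (Fin n → ℝ) → Cube n
  side_q : ∀ k x, (q k x).side = (2 : ℝ) ^ k
  mem_q : ∀ k x, x ∈ (q k x).toSet
  eq_q : ∀ k x y, y ∈ (q k x).toSet → q k y = q k x
  sub_succ : ∀ k x, (q k x).toSet ⊆ (q (k + 1) x).toSet
  countable_q : ∀ k, (Set.range (q k)).Countable

namespace Gr

variable {n : ℕ} (G : Gr n)

lemma sub_q {k k' : ℤ} (h : k ≤ k') (x : Fin n → ℝ) : (G.q k x).toSet ⊆ (G.q k' x).toSet := by
  induction k', h using Int.leInduction with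
  | base => exact subset_rfl
  | succ j hj ih => exact ih.trans (G.sub_succ j x)

lemma eq_of_mem {k k' : ℤ} (h : k ≤ k') {x y : Fin n → ℝ} (hy : y ∈ (G.q k x).toSet) :
    G.q k' y = G.q k' x := G.eq_q _ _ _ (G.sub_q h x hy)

/-- The family of all cubes of the grid. -/
def D : Set (Cube n) := {Q | ∃ k x, Q = G.q k x}

lemma isDyadicGrid : IsDyadicGrid G.D := by
  refine ⟨?_, ?_, ?_⟩
  · rintro Q ⟨k, x, rfl⟩
    exact ⟨k, G.side_q k x⟩
  · have key : ∀ k k' x y, k ≤ k' → (G.q k x).toSet ∩ (G.q k' y).toSet = (G.q k x).toSet ∨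
        (G.q k x).toSet ∩ (G.q k' y).toSet = ∅ := by
      intro k k' x y h
      rcases Set.eq_empty_or_nonempty ((G.q k x).toSet ∩ (G.q k' y).toSet) with h0 | ⟨z, hz, hz'⟩
      · exact Or.inr h0
      · left
        rw [Set.inter_eq_left, ← G.eq_q _ _ _ hz, ← G.eq_q _ _ _ hz']
        exact G.sub_q h z
    rintro Q ⟨k, x, rfl⟩ R ⟨k', y, rfl⟩
    rcases le_total k k' with h | h
    · rcases key k k' x y h with h | h
      · exact Or.inl h
      · exact Or.inr (Or.inr h)
    · rcases key k' k y x h with h | h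
      · rw [Set.inter_comm] at h
        exact Or.inr (Or.inl h)
      · rw [Set.inter_comm] at h
        exact Or.inr (Or.inr h)
  · intro k x
    refine ⟨G.q k x, ⟨⟨k, x, rfl⟩, G.side_q k x, G.mem_q k x⟩, ?_⟩
    rintro Q ⟨⟨k', y, rfl⟩, hs, hx⟩
    rw [G.side_q] at hs
    obtain rfl := two_zpow_inj hs
    exact (G.eq_q _ _ _ hx).symm

/-- A set which is a union of grid cubes of side `2^k`. -/
def Inv (k : ℤ) (E : Set (Fin n → ℝ)) : Prop := ∀ x ∈ E, (G.q k x).toSet ⊆ E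

variable {G}

lemma Inv.eq_biUnion {k : ℤ} {E : Set (Fin n → ℝ)} (hE : G.Inv k E) :
    E = ⋃ Q ∈ {Q | Q ∈ Set.range (G.q k) ∧ Q.toSet ⊆ E}, Q.toSet := by
  apply Set.Subset.antisymm
  · intro x hx
    simp only [mem_iUnion]
    exact ⟨G.q k x, ⟨⟨x, rfl⟩, hE x hx⟩, G.mem_q k x⟩
  · intro x hx
    simp only [mem_iUnion] at hx
    obtain ⟨Q, hQ, hx⟩ := hx
    exact hQ.2 hx

lemma countable_sub (k : ℤ) (E : Set (Fin n → ℝ)) :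
    {Q | Q ∈ Set.range (G.q k) ∧ Q.toSet ⊆ E}.Countable :=
  (G.countable_q k).mono fun _ h => h.1

lemma Inv.measurableSet {k : ℤ} {E : Set (Fin n → ℝ)} (hE : G.Inv k E) : MeasurableSet E := by
  rw [hE.eq_biUnion]
  exact MeasurableSet.biUnion (countable_sub k E) fun Q _ => measurableSet_toSet Q

lemma Inv.measure_le {k : ℤ} {E : Set (Fin n → ℝ)} (hE : G.Inv k E)
    (μ ν : Measure (Fin n → ℝ)) (h : ∀ x ∈ E, μ (G.q k x).toSet ≤ ν (G.q k x).toSet) :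
    μ E ≤ ν E := by
  have hd : {Q | Q ∈ Set.range (G.q k) ∧ Q.toSet ⊆ E}.PairwiseDisjoint Cube.toSet := by
    rintro Q ⟨⟨x, rfl⟩, -⟩ R ⟨⟨y, rfl⟩, -⟩ hne
    rw [Function.onFun, Set.disjoint_left]
    intro z hz hz'
    exact hne ((G.eq_q _ _ _ hz).symm.trans (G.eq_q _ _ _ hz'))
  have e := hE.eq_biUnion
  have e1 : ∀ ρ : Measure (Fin n → ℝ), ρ E =
      ∑' Q : {Q | Q ∈ Set.range (G.q k) ∧ Q.toSet ⊆ E}, ρ Q.1.toSet := by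
    intro ρ
    conv_lhs => rw [e]
    exact measure_biUnion (countable_sub k E) hd fun Q _ => measurableSet_toSet Q
  rw [e1 μ, e1 ν]
  refine ENNReal.tsum_le_tsum ?_
  rintro ⟨Q, ⟨x, rfl⟩, hQ⟩
  exact h x (hQ (G.mem_q k x))

lemma maximal (μ ν : Measure (Fin n → ℝ)) (t : ℤ) (x₀ : Fin n → ℝ)
    (P : ℤ → (Fin n → ℝ) → Prop)
    (hP : ∀ k, k < t → ∀ x y, y ∈ (G.q k x).toSet → P k x → P k y)
    (h : ∀ k, k < t → ∀ y ∈ (G.q t x₀).toSet, P k y → μ (G.q k y).toSet ≤ ν (G.q k y).toSet) :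
    μ {y | y ∈ (G.q t x₀).toSet ∧ ∃ k < t, P k y} ≤ ν (G.q t x₀).toSet := by
  set E : ℤ → Set (Fin n → ℝ) := fun k =>
    {y | y ∈ (G.q t x₀).toSet ∧ k < t ∧ P k y ∧ ∀ k', k < k' → k' < t → ¬ P k' y} with hEdef
  have hinv : ∀ k, G.Inv k (E k) := by
    rintro k x ⟨hx, hk, hp, hm⟩ y hy
    have hyx : ∀ k', k ≤ k' → x ∈ (G.q k' y).toSet := fun k' hk' => by
      rw [G.eq_of_mem hk' hy]; exact G.mem_q _ _
    refine ⟨?_, hk, hP k hk x y hy hp, ?_⟩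
    · rw [← G.eq_q _ _ _ hx]
      exact G.sub_q hk.le _ hy
    · intro k' h1 h2 h3
      exact hm k' h1 h2 (hP k' h2 y x (hyx k' h1.le) h3)
  have hdisj : Pairwise (Function.onFun Disjoint E) := by
    intro a b hab
    rw [Function.onFun, Set.disjoint_left]
    rintro y ⟨-, ha, hpa, hma⟩ ⟨-, hb, hpb, hmb⟩
    rcases lt_or_gt_of_ne hab with h | h
    · exact hma b h hb hpb
    · exact hmb a h ha hpa
  have hsub : {y | y ∈ (G.q t x₀).toSet ∧ ∃ k < t, P k y} ⊆ ⋃ k, E k := by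
    rintro y ⟨hy, k, hk, hp⟩
    obtain ⟨k₁, ⟨hk₁, hp₁⟩, hmax⟩ := Int.exists_greatest_of_bdd
      (P := fun k => k < t ∧ P k y) ⟨t, fun z hz => hz.1.le⟩ ⟨k, hk, hp⟩
    refine mem_iUnion.2 ⟨k₁, hy, hk₁, hp₁, fun k' h1 h2 h3 => ?_⟩
    exact absurd (hmax k' ⟨h2, h3⟩) (not_le.2 h1)
  calc _ ≤ μ (⋃ k, E k) := measure_mono hsub
    _ ≤ ∑' k, μ (E k) := measure_iUnion_le _
    _ ≤ ∑' k, ν (E k) := ENNReal.tsum_le_tsum fun k =>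
        (hinv k).measure_le μ ν fun x hx => h k hx.2.1 x hx.1 hx.2.2.1
    _ = ν (⋃ k, E k) := (measure_iUnion hdisj fun k => (hinv k).measurableSet).symm
    _ ≤ _ := measure_mono (iUnion_subset fun k y hy => hy.1)

/-- Dyadic weak type (1,1). -/
lemma weak_type (A : ℝ≥0∞) (hA : A ≠ 0) (hA' : A ≠ ∞) (g : (Fin n → ℝ) → ℝ)
    (hg : Integrable g) (t : ℤ) (x₀ : Fin n → ℝ) :
    volume {y | y ∈ (G.q t x₀).toSet ∧ ∃ k < t, A * cubeAvg (G.q t y) g < cubeAvg (G.q k y) g} ≤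
      volume (G.q t x₀).toSet / A := by
  set I : ℝ≥0∞ := ∫⁻ x in (G.q t x₀).toSet, ENNReal.ofReal |g x| with hI
  set V := volume (G.q t x₀).toSet with hV
  have hV0 : V ≠ 0 := volume_ne_zero _
  have hVt : V ≠ ∞ := volume_ne_top _
  have hIt : I ≠ ∞ := by
    have := hg.norm.lintegral_lt_top
    refine ne_top_of_le_ne_top this.ne ?_
    simpa only [Real.norm_eq_abs] using setLIntegral_le_lintegral _ _
  rcases eq_or_ne I 0 with h0 | h0
  · have : {y | y ∈ (G.q t x₀).toSet ∧ ∃ k < t, A * cubeAvg (G.q t y) g < cubeAvg (G.q k y) g}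
        = ∅ := by
      rw [Set.eq_empty_iff_forall_notMem]
      rintro y ⟨hy, k, hk, h⟩
      have h1 : ∫⁻ x in (G.q k y).toSet, ENNReal.ofReal |g x| = 0 := by
        refine le_antisymm ?_ zero_le
        rw [← h0, hI, ← G.eq_q _ _ _ hy]
        exact lintegral_mono_set (G.sub_q hk.le y)
      simp [cubeAvg, h1] at h
    rw [this]; simp
  · have hlam0 : A * (I / V) ≠ 0 := mul_ne_zero hA (ENNReal.div_ne_zero.2 ⟨h0, hVt⟩)
    have hlamt : A * (I / V) ≠ ∞ := ENNReal.mul_ne_top hA' (ENNReal.div_ne_top hIt hV0)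
    have := maximal (G := G) volume
      ((A * (I / V))⁻¹ • volume.withDensity fun x => ENNReal.ofReal |g x|) t x₀
      (fun k y => A * cubeAvg (G.q t y) g < cubeAvg (G.q k y) g) ?_ ?_
    · refine this.trans (le_of_eq ?_)
      rw [Measure.smul_apply, withDensity_apply _ (measurableSet_toSet _), ← hI, smul_eq_mul]
      rw [ENNReal.mul_inv (Or.inl hA) (Or.inl hA'), ENNReal.inv_div (Or.inl hVt) (Or.inl hV0),
        mul_assoc, ENNReal.div_mul_cancel h0 hIt, mul_comm, div_eq_mul_inv]
    · intro k hk x y hy h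
      rw [G.eq_q _ _ _ hy, G.eq_of_mem hk.le hy]
      exact h
    · intro k hk y hy h
      rw [G.eq_q _ _ _ hy] at h
      rw [Measure.smul_apply, withDensity_apply _ (measurableSet_toSet _), smul_eq_mul,
        mul_comm, ← div_eq_mul_inv, ENNReal.le_div_iff_mul_le (Or.inl hlam0) (Or.inl hlamt),
        mul_comm, ← ENNReal.le_div_iff_mul_le (Or.inl (volume_ne_zero _))
          (Or.inl (volume_ne_top _))]
      exact h.le

end Gr

/-! ### Stopping times and the associated sparse families -/

section stopping

variable {n : ℕ}

/-- The `j`-th stopping scale of `x`. -/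
def Stop (B : ℤ → ℤ → (Fin n → ℝ) → Prop) (N : ℤ) : ℕ → ℤ → (Fin n → ℝ) → Prop
  | 0, k, _ => k = N
  | j + 1, k, x => ∃ t, Stop B N j t x ∧ k < t ∧ B t k x ∧ ∀ k', k < k' → k' < t → ¬ B t k' x

/-- Stopping scales, extended to negative generations. -/
def lvl (B : ℤ → ℤ → (Fin n → ℝ) → Prop) (N : ℤ) : ℤ → ℤ → (Fin n → ℝ) → Prop
  | Int.ofNat j => Stop B N j
  | Int.negSucc d => fun k _ => k = N + d + 1

variable {B : ℤ → ℤ → (Fin n → ℝ) → Prop} {N : ℤ}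

lemma lvl_nonpos {j : ℤ} (hj : j ≤ 0) (k : ℤ) (x : Fin n → ℝ) : lvl B N j k x ↔ k = N - j := by
  cases j with
  | ofNat j =>
    have : j = 0 := by simpa using hj
    subst this
    simp [lvl, Stop]
  | negSucc d =>
    simp only [lvl, Int.negSucc_eq]
    constructor <;> intro h <;> omega

lemma lvl_succ {j k : ℤ} {x : Fin n → ℝ} (h : lvl B N (j + 1) k x) :
    ∃ t, lvl B N j t x ∧ k < t ∧ (0 ≤ j → B t k x) := by
  rcases le_or_gt 0 j with hj | hj
  · lift j to ℕ using hj
    obtain ⟨t, h1, h2, h3, -⟩ := h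
    exact ⟨t, h1, h2, fun _ => h3⟩
  · rw [lvl_nonpos (by omega)] at h
    refine ⟨N - j, (lvl_nonpos hj.le _ _).2 rfl, by omega, fun h => by omega⟩

lemma Stop_unique {j : ℕ} {k k' : ℤ} {x : Fin n → ℝ} (h : Stop B N j k x)
    (h' : Stop B N j k' x) : k = k' := by
  induction j generalizing k k' with
  | zero => exact h.trans h'.symm
  | succ j ih =>
    obtain ⟨t, h1, h2, h3, h4⟩ := h
    obtain ⟨t', h1', h2', h3', h4'⟩ := h'
    obtain rfl := ih h1 h1'
    rcases lt_trichotomy k k' with h | h | h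
    · exact absurd h3' (h4 k' h h2')
    · exact h
    · exact absurd h3 (h4' k h h2)

lemma lvl_unique {j k k' : ℤ} {x : Fin n → ℝ} (h : lvl B N j k x)
    (h' : lvl B N j k' x) : k = k' := by
  cases j with
  | ofNat j => exact Stop_unique h h'
  | negSucc d => exact Eq.trans h (Eq.symm h')

variable {G : Gr n}

lemma Stop_inv (hB : ∀ t k, k < t → ∀ x y, y ∈ (G.q k x).toSet → B t k x → B t k y)
    {j : ℕ} {k : ℤ} {x y : Fin n → ℝ} (h : Stop B N j k x) (hy : y ∈ (G.q k x).toSet) :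
    Stop B N j k y := by
  induction j generalizing k with
  | zero => exact h
  | succ j ih =>
    obtain ⟨t, h1, h2, h3, h4⟩ := h
    refine ⟨t, ih h1 (G.sub_q h2.le _ hy), h2, hB t k h2 x y hy h3, fun k' a b c => ?_⟩
    refine h4 k' a b (hB t k' b y x ?_ c)
    rw [G.eq_of_mem a.le hy]
    exact G.mem_q _ _

lemma lvl_inv (hB : ∀ t k, k < t → ∀ x y, y ∈ (G.q k x).toSet → B t k x → B t k y)
    {j k : ℤ} {x y : Fin n → ℝ} (h : lvl B N j k x) (hy : y ∈ (G.q k x).toSet) :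
    lvl B N j k y := by
  cases j with
  | ofNat j => exact Stop_inv hB h hy
  | negSucc d => exact h

/-- The sparse family of stopping cubes under `q N v`. -/
def stopFamily (hn : n ≠ 0) (G : Gr n) (B : ℤ → ℤ → (Fin n → ℝ) → Prop)
    (hB : ∀ t k, k < t → ∀ x y, y ∈ (G.q k x).toSet → B t k x → B t k y)
    (hm : ∀ t x, volume {y | y ∈ (G.q t x).toSet ∧ ∃ k < t, B t k y} ≤ volume (G.q t x).toSet / 2)
    (N : ℤ) (v : Fin n → ℝ) : SparseFamily n where
  cubes j := {Q | ∃ x k, x ∈ (G.q N v).toSet ∧ lvl B N j k x ∧ Q = G.q k x}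
  pairwiseDisjoint := by
    rintro j Q ⟨x, k, hx, hk, rfl⟩ R ⟨y, k', hy, hk', rfl⟩ hne
    rw [Function.onFun, Set.disjoint_left]
    intro z hz hz'
    have h1 := lvl_inv hB hk hz
    have h2 := lvl_inv hB hk' hz'
    obtain rfl := lvl_unique h1 h2
    exact hne ((G.eq_q _ _ _ hz).symm.trans (G.eq_q _ _ _ hz'))
  nested := by
    intro j z hz
    simp only [mem_iUnion] at hz ⊢
    obtain ⟨Q, ⟨x, k, hx, hk, rfl⟩, hz⟩ := hz
    obtain ⟨t, h1, h2, -⟩ := lvl_succ hk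
    exact ⟨G.q t x, ⟨x, t, hx, h1, rfl⟩, G.sub_q h2.le _ hz⟩
  sparse := by
    rintro j Q ⟨x, t, hx, ht, rfl⟩
    rcases le_or_gt 0 j with hj | hj
    · refine (measure_mono ?_).trans (hm t x)
      rintro y ⟨hy, hyQ⟩
      simp only [mem_iUnion] at hy
      obtain ⟨R, ⟨x', k, hx', hk, rfl⟩, hy⟩ := hy
      obtain ⟨t', h1, h2, h3⟩ := lvl_succ (lvl_inv hB hk hy)
      obtain rfl := lvl_unique h1 (lvl_inv hB ht hyQ)
      exact ⟨hyQ, k, h2, h3 hj⟩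
    · rw [lvl_nonpos hj.le] at ht
      have hsub : ((⋃ R ∈ {Q | ∃ x k, x ∈ (G.q N v).toSet ∧ lvl B N (j + 1) k x ∧ Q = G.q k x},
          R.toSet) ∩ (G.q t x).toSet) ⊆ (G.q (t - 1) v).toSet := by
        rintro y ⟨hy, hyQ⟩
        simp only [mem_iUnion] at hy
        obtain ⟨R, ⟨x', k, hx', hk, rfl⟩, hy⟩ := hy
        rw [lvl_nonpos (by omega)] at hk
        have : k = t - 1 := by omega
        subst this
        rwa [G.eq_of_mem (by omega) hx'] at hy
      refine (measure_mono hsub).trans ?_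
      rw [volume_toSet, volume_toSet, G.side_q, G.side_q]
      have : (2 : ℝ) ^ t = 2 * 2 ^ (t - 1) := by
        rw [zpow_sub_one₀ (by norm_num)]; ring
      rw [this, ENNReal.ofReal_mul (by norm_num), mul_pow,
        ENNReal.le_div_iff_mul_le (by simp) (by simp), mul_comm]
      gcongr
      simpa using le_self_pow₀ (M₀ := ℝ≥0∞) (a := 2) (by norm_num) hn

lemma exists_asg (x : Fin n → ℝ) (r : ℤ) (hr : r ≤ N) :
    ∃ j t, Stop B N j t x ∧ r ≤ t ∧ (r = t ∨ ¬ B t r x) := by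
  have key : ∀ d : ℕ, ∀ j t, Stop B N j t x → r ≤ t → t - r ≤ d →
      ∃ j t, Stop B N j t x ∧ r ≤ t ∧ (r = t ∨ ¬ B t r x) := by
    intro d
    induction d with
    | zero =>
      intro j t h1 h2 h3
      exact ⟨j, t, h1, h2, Or.inl (by push_cast at h3; omega)⟩
    | succ d ih =>
      intro j t h1 h2 h3
      by_cases h : r = t ∨ ¬ B t r x
      · exact ⟨j, t, h1, h2, h⟩
      · push Not at h
        obtain ⟨k₁, ⟨hk₁, hp₁⟩, hmax⟩ := Int.exists_greatest_of_bdd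
          (P := fun k => k < t ∧ B t k x) ⟨t, fun z hz => hz.1.le⟩ ⟨r, by omega, h.2⟩
        have hrk : r ≤ k₁ := hmax r ⟨by omega, h.2⟩
        refine ih (j + 1) k₁ ⟨t, h1, hk₁, hp₁, fun k' a b c => ?_⟩ hrk (by push_cast at h3; omega)
        have := hmax k' ⟨b, c⟩
        omega
  exact key (N - r).toNat 0 N rfl hr (by omega)

end stopping

/-! ### Carleson packing of sparse families -/

section carleson

variable {n : ℕ}

/-- The indexed cubes of a sparse family. -/
abbrev Idx (S : SparseFamily n) := Σ k : ℤ, S.cubes k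

/-- The cube of an index. -/
def cb {S : SparseFamily n} (p : Idx S) : Cube n := p.2.1

lemma countable_cubes (S : SparseFamily n) (k : ℤ) : (S.cubes k).Countable := by
  refine (S.pairwiseDisjoint k).countable_of_nonempty_interior fun Q _ => ?_
  have h : Set.pi univ (fun i => Set.Ioo (Q.corner i) (Q.corner i + Q.side)) ⊆
      interior Q.toSet := by
    apply interior_maximal
    · rw [toSet_eq_pi]
      exact Set.pi_mono fun i _ => Set.Ioo_subset_Ico_self
    · exact isOpen_set_pi Set.finite_univ fun i _ => isOpen_Ioo
  refine ⟨fun i => Q.corner i + Q.side / 2, h fun i _ => ?_⟩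
  have := Q.side_pos
  constructor <;> linarith

instance (S : SparseFamily n) : Countable (Idx S) := by
  have : ∀ k, Countable (S.cubes k) := fun k => (countable_cubes S k).to_subtype
  infer_instance

/-- `Ω_k`. -/
def Om (S : SparseFamily n) (k : ℤ) : Set (Fin n → ℝ) := ⋃ Q ∈ S.cubes k, Q.toSet

lemma Om_anti (S : SparseFamily n) {k k' : ℤ} (h : k ≤ k') : Om S k' ⊆ Om S k := by
  induction k', h using Int.leInduction with
  | base => exact subset_rfl
  | succ j hj ih => exact (S.nested j).trans ih

lemma cb_sub_Om {S : SparseFamily n} (p : Idx S) : (cb p).toSet ⊆ Om S p.1 :=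
  fun _ hx => mem_biUnion p.2.2 hx

lemma half_le {S : SparseFamily n} (p : Idx S) :
    volume (cb p).toSet ≤ 2 * volume ((cb p).toSet \ Om S (p.1 + 1)) := by
  have h1 := S.sparse p.1 (cb p) p.2.2
  have h2 : volume (cb p).toSet ≤ volume (Om S (p.1 + 1) ∩ (cb p).toSet) +
      volume ((cb p).toSet \ Om S (p.1 + 1)) := by
    rw [Set.inter_comm]
    exact measure_le_inter_add_sdiff _ _ _
  set V := volume (cb p).toSet
  have hV : V ≠ ∞ := volume_ne_top _
  have h3 : V / 2 + V / 2 ≤ V / 2 + volume ((cb p).toSet \ Om S (p.1 + 1)) := by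
    rw [ENNReal.add_halves]
    exact h2.trans (by gcongr; exact h1)
  have h4 := (ENNReal.add_le_add_iff_left (ENNReal.div_ne_top hV (by norm_num))).1 h3
  calc V = V / 2 + V / 2 := (ENNReal.add_halves V).symm
    _ = 2 * (V / 2) := (two_mul _).symm
    _ ≤ _ := by gcongr

lemma cb_ne {S : SparseFamily n} {p p' : Idx S} (h : p.1 < p'.1)
    (hc : (cb p).toSet = (cb p').toSet) : False := by
  have h1 := half_le p
  have h2 : (cb p).toSet \ Om S (p.1 + 1) = ∅ := by
    rw [Set.sdiff_eq_empty, hc]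
    exact (cb_sub_Om p').trans (Om_anti S (by omega))
  rw [h2] at h1
  simp at h1
  exact volume_ne_zero _ h1

open Classical in
lemma carleson (S : SparseFamily n) (U : Set (Fin n → ℝ)) :
    ∑' p : Idx S, (if (cb p).toSet ⊆ U then volume (cb p).toSet else 0) ≤ 2 * volume U := by
  set E : Idx S → Set (Fin n → ℝ) := fun p =>
    if (cb p).toSet ⊆ U then (cb p).toSet \ Om S (p.1 + 1) else ∅ with hE
  have hmeas : ∀ p, MeasurableSet (E p) := by
    intro p
    simp only [hE]
    split_ifs
    · exact (measurableSet_toSet _).diff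
        (MeasurableSet.biUnion (countable_cubes S _) fun Q _ => measurableSet_toSet Q)
    · exact MeasurableSet.empty
  have hsubE : ∀ p, E p ⊆ (cb p).toSet \ Om S (p.1 + 1) := by
    intro p
    simp only [hE]
    split_ifs
    · exact subset_rfl
    · exact empty_subset _
  have hd : Pairwise (Function.onFun Disjoint E) := by
    have key : ∀ p p' : Idx S, p.1 < p'.1 → Disjoint (E p) (E p') := by
      intro p p' h
      rw [Set.disjoint_left]
      intro z hz hz'
      exact (hsubE p hz).2 (Om_anti S (by omega) (cb_sub_Om p' (hsubE p' hz').1))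
    intro p p' hne
    rcases lt_trichotomy p.1 p'.1 with h | h | h
    · exact key p p' h
    · obtain ⟨k, Q, hQ⟩ := p
      obtain ⟨k', Q', hQ'⟩ := p'
      dsimp only at h
      subst h
      have hQQ : Q ≠ Q' := by
        rintro rfl
        exact hne rfl
      exact (S.pairwiseDisjoint k hQ hQ' hQQ).mono (fun z hz => (hsubE _ hz).1)
        (fun z hz => (hsubE _ hz).1)
    · exact (key p' p h).symm
  calc _ ≤ ∑' p, 2 * volume (E p) := by
        refine ENNReal.tsum_le_tsum fun p => ?_
        simp only [hE]
        split_ifs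
        · exact half_le p
        · exact zero_le
    _ = 2 * ∑' p, volume (E p) := ENNReal.tsum_mul_left
    _ = 2 * volume (⋃ p, E p) := by rw [measure_iUnion hd hmeas]
    _ ≤ _ := by
        gcongr
        refine iUnion_subset fun p => ?_
        simp only [hE]
        split_ifs with h
        · exact sdiff_subset.trans h
        · exact empty_subset _

lemma three_pos : (0 : ℝ) < 3 := by norm_num

lemma volume_three (Q : Cube n) :
    volume (Q.dilate 3 three_pos).toSet = 3 ^ n * volume Q.toSet := by
  rw [volume_toSet, volume_toSet, ← mul_pow]
  congr 1
  simp only [Cube.dilate]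
  rw [ENNReal.ofReal_mul (by norm_num)]
  norm_num

lemma sub_three {Q R : Cube n} (h : R.side ≤ Q.side) (hne : (R.toSet ∩ Q.toSet).Nonempty) :
    R.toSet ⊆ (Q.dilate 3 three_pos).toSet := by
  obtain ⟨z, hz, hz'⟩ := hne
  intro y hy i
  have := hy i
  have := hz i
  have := hz' i
  simp only [Cube.dilate]
  constructor <;> linarith

/-- A grid cube of side `2^s` is marked if it meets a cube of `S` of the same side. -/
def mark (G : Gr n) (S : SparseFamily n) (s : ℤ) (x : Fin n → ℝ) : Prop :=
  ∃ p : Idx S, (cb p).side = (2 : ℝ) ^ s ∧ ((cb p).toSet ∩ (G.q s x).toSet).Nonempty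

lemma mark_inv {G : Gr n} {S : SparseFamily n} {s k : ℤ} (h : k ≤ s) {x y : Fin n → ℝ}
    (hy : y ∈ (G.q k x).toSet) : mark G S s y ↔ mark G S s x := by
  rw [mark, mark, G.eq_of_mem h hy]

open Classical in
lemma mark_meas (G : Gr n) (S : SparseFamily n) (t : ℤ) (x₀ : Fin n → ℝ) :
    ∑' s : ℤ, (if s ≤ t then volume {y | y ∈ (G.q t x₀).toSet ∧ mark G S s y} else 0) ≤
      2 * 9 ^ n * volume (G.q t x₀).toSet := by
  set Q := G.q t x₀ with hQ
  have h1 : ∀ s : ℤ, (if s ≤ t then volume {y | y ∈ Q.toSet ∧ mark G S s y} else 0) ≤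
      ∑' p : Idx S, (if (cb p).side = (2 : ℝ) ^ s then
        3 ^ n * (if (cb p).toSet ⊆ (Q.dilate 3 three_pos).toSet then volume (cb p).toSet else 0)
        else 0) := by
    intro s
    split_ifs with hs
    · have hsub : {y | y ∈ Q.toSet ∧ mark G S s y} ⊆ ⋃ p : Idx S,
          (if (cb p).side = (2 : ℝ) ^ s ∧ (cb p).toSet ⊆ (Q.dilate 3 three_pos).toSet then
            ((cb p).dilate 3 three_pos).toSet else ∅) := by
        rintro y ⟨hy, p, hp, hne⟩
        refine mem_iUnion.2 ⟨p, ?_⟩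
        rw [if_pos]
        · refine sub_three (Q := cb p) (R := G.q s y) ?_ ?_ (G.mem_q s y)
          · rw [hp, G.side_q]
          · rwa [Set.inter_comm]
        · refine ⟨hp, sub_three ?_ ?_⟩
          · rw [hp, hQ, G.side_q]
            exact zpow_le_zpow_right₀ (by norm_num) hs
          · refine hne.mono (Set.inter_subset_inter_right _ ?_)
            rw [hQ, ← G.eq_q _ _ _ hy]
            exact G.sub_q hs y
      refine (measure_mono hsub).trans ((measure_iUnion_le _).trans ?_)
      refine ENNReal.tsum_le_tsum fun p => ?_
      by_cases a : (cb p).side = (2 : ℝ) ^ s <;>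
        by_cases b : (cb p).toSet ⊆ (Q.dilate 3 three_pos).toSet <;>
        simp [a, b, volume_three]
    · exact zero_le
  refine (ENNReal.tsum_le_tsum h1).trans ?_
  rw [ENNReal.tsum_comm]
  have h2 : ∀ p : Idx S, ∑' s : ℤ, (if (cb p).side = (2 : ℝ) ^ s then
        3 ^ n * (if (cb p).toSet ⊆ (Q.dilate 3 three_pos).toSet then volume (cb p).toSet else 0)
        else (0 : ℝ≥0∞)) ≤
      3 ^ n * (if (cb p).toSet ⊆ (Q.dilate 3 three_pos).toSet then volume (cb p).toSet else 0) := by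
    intro p
    by_cases h : ∃ s : ℤ, (cb p).side = (2 : ℝ) ^ s
    · obtain ⟨s, hs⟩ := h
      rw [tsum_eq_single s]
      · split_ifs <;> simp
      · intro s' hs'
        rw [if_neg]
        intro h
        exact hs' (two_zpow_inj (h.symm.trans hs))
    · push Not at h
      simp [h]
  refine (ENNReal.tsum_le_tsum h2).trans ?_
  rw [ENNReal.tsum_mul_left]
  calc _ ≤ (3 : ℝ≥0∞) ^ n * (2 * volume (Q.dilate 3 three_pos).toSet) := by
        gcongr
        exact carleson S _
    _ = 2 * 9 ^ n * volume Q.toSet := by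
        rw [volume_three, show (9 : ℝ≥0∞) = 3 * 3 by norm_num, mul_pow]
        ring

open Classical in
/-- Number of marked scales in a range. -/
def cnt (G : Gr n) (S : SparseFamily n) (L : ℕ) (t k : ℤ) (x : Fin n → ℝ) : ℝ≥0∞ :=
  ∑' s : ℤ, if k ≤ s ∧ s + L ≤ t ∧ mark G S s x then 1 else 0

lemma cnt_inv {G : Gr n} {S : SparseFamily n} {L : ℕ} {t k : ℤ} {x y : Fin n → ℝ}
    (hy : y ∈ (G.q k x).toSet) : cnt G S L t k y = cnt G S L t k x := by
  unfold cnt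
  refine tsum_congr fun s => ?_
  classical
  refine if_congr ?_ rfl rfl
  constructor
  · exact fun h => ⟨h.1, h.2.1, (mark_inv h.1 hy).1 h.2.2⟩
  · exact fun h => ⟨h.1, h.2.1, (mark_inv h.1 hy).2 h.2.2⟩

lemma cnt_meas (G : Gr n) (S : SparseFamily n) (L : ℕ) (K : ℝ≥0∞) (hK : K ≠ 0) (hK' : K ≠ ∞)
    (t : ℤ) (x₀ : Fin n → ℝ) :
    volume {y | y ∈ (G.q t x₀).toSet ∧ ∃ k < t, K < cnt G S L t k y} ≤
      2 * 9 ^ n * volume (G.q t x₀).toSet / K := by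
  classical
  set Q := G.q t x₀ with hQ
  have hms : ∀ s : ℤ, s ≤ t → MeasurableSet {y | y ∈ Q.toSet ∧ mark G S s y} := by
    intro s hs
    refine Gr.Inv.measurableSet (G := G) (k := s) ?_
    rintro x ⟨hx, hx'⟩ y hy
    refine ⟨?_, (mark_inv le_rfl hy).2 hx'⟩
    rw [hQ, ← G.eq_q _ _ _ hx]
    exact G.sub_q hs x hy
  set F : ℤ → (Fin n → ℝ) → ℝ≥0∞ := fun s =>
    if s ≤ t then {y | y ∈ Q.toSet ∧ mark G S s y}.indicator (fun _ => 1) else fun _ => 0 with hF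
  have hFm : ∀ s, Measurable (F s) := by
    intro s
    simp only [hF]
    split_ifs with h
    · exact measurable_const.indicator (hms s h)
    · exact measurable_const
  have hIntBd : ∫⁻ y, ∑' s, F s y ≤ 2 * 9 ^ n * volume Q.toSet := by
    rw [lintegral_tsum fun s => (hFm s).aemeasurable]
    refine le_trans (le_of_eq ?_) (mark_meas G S t x₀)
    congr 1
    ext s
    simp only [hF]
    split_ifs with h
    · rw [lintegral_indicator (hms s h)]
      simp [hQ]
    · simp
  rw [ENNReal.le_div_iff_mul_le (Or.inl hK) (Or.inl hK'), mul_comm]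
  refine le_trans ?_ hIntBd
  refine le_trans ?_ (mul_meas_ge_le_lintegral (Measurable.tsum hFm) K)
  gcongr
  rintro ⟨hy, k, hk, h⟩
  refine h.le.trans (ENNReal.tsum_le_tsum fun s => ?_)
  split_ifs with h
  · have : s ≤ t := by omega
    simp only [hF, if_pos this]
    rw [Set.indicator_of_mem]
    exact ⟨hy, h.2.2⟩
  · exact zero_le

end carleson

/-! ### Domination in a single grid -/

section domination

variable {n m : ℕ}

/-- The stopping condition. -/
def stB (G : Gr n) (S : SparseFamily n) (f : Fin m → (Fin n → ℝ) → ℝ) (A K : ℝ≥0∞) (L : ℕ)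
    (t k : ℤ) (x : Fin n → ℝ) : Prop :=
  (∃ i, A * cubeAvg (G.q t x) (f i) < cubeAvg (G.q k x) (f i)) ∨ K < cnt G S L t k x

lemma stB_inv {G : Gr n} {S : SparseFamily n} {f : Fin m → (Fin n → ℝ) → ℝ} {A K : ℝ≥0∞} {L : ℕ}
    (t k : ℤ) (hk : k < t) (x y : Fin n → ℝ) (hy : y ∈ (G.q k x).toSet)
    (h : stB G S f A K L t k x) : stB G S f A K L t k y := by
  rw [stB, G.eq_q _ _ _ hy, G.eq_of_mem hk.le hy, cnt_inv hy]
  exact h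

lemma stB_meas (hm : 0 < m) (G : Gr n) (S : SparseFamily n) (f : Fin m → (Fin n → ℝ) → ℝ) (L : ℕ)
    (hf : ∀ i, Integrable (f i)) (t : ℤ) (x : Fin n → ℝ) :
    volume {y | y ∈ (G.q t x).toSet ∧ ∃ k < t, stB G S f (4 * m) (8 * 9 ^ n) L t k y} ≤
      volume (G.q t x).toSet / 2 := by
  have hm0 : (m : ℝ≥0∞) ≠ 0 := by exact_mod_cast hm.ne'
  have hmt : (m : ℝ≥0∞) ≠ ∞ := ENNReal.natCast_ne_top m
  set V := volume (G.q t x).toSet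
  have hsub : {y | y ∈ (G.q t x).toSet ∧ ∃ k < t, stB G S f (4 * m) (8 * 9 ^ n) L t k y} ⊆
      (⋃ i, {y | y ∈ (G.q t x).toSet ∧
        ∃ k < t, 4 * (m : ℝ≥0∞) * cubeAvg (G.q t y) (f i) < cubeAvg (G.q k y) (f i)}) ∪
      {y | y ∈ (G.q t x).toSet ∧ ∃ k < t, 8 * 9 ^ n < cnt G S L t k y} := by
    rintro y ⟨hy, k, hk, ⟨i, hi⟩ | h⟩
    · exact Or.inl (mem_iUnion.2 ⟨i, hy, k, hk, hi⟩)
    · exact Or.inr ⟨hy, k, hk, h⟩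
  have h9 : (9 : ℝ≥0∞) ^ n ≠ 0 := pow_ne_zero _ (by norm_num)
  have h9' : (9 : ℝ≥0∞) ^ n ≠ ∞ := ENNReal.pow_ne_top (by norm_num)
  have h1 : volume (⋃ i, {y | y ∈ (G.q t x).toSet ∧
        ∃ k < t, 4 * (m : ℝ≥0∞) * cubeAvg (G.q t y) (f i) < cubeAvg (G.q k y) (f i)}) ≤ V / 4 := by
    refine (measure_iUnion_le _).trans ?_
    rw [tsum_fintype]
    refine (Finset.sum_le_sum fun i _ => Gr.weak_type (4 * m) (mul_ne_zero (by norm_num) hm0)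
      (ENNReal.mul_ne_top (by norm_num) hmt) (f i) (hf i) t x).trans (le_of_eq ?_)
    rw [Finset.sum_const, Finset.card_univ, Fintype.card_fin, nsmul_eq_mul, mul_comm (4 : ℝ≥0∞),
      ← mul_div_assoc, ENNReal.mul_div_mul_left _ _ hm0 hmt]
  have h2 := cnt_meas G S L (8 * 9 ^ n) (mul_ne_zero (by norm_num) h9)
      (ENNReal.mul_ne_top (by norm_num) h9') t x
  have h3 : 2 * 9 ^ n * V / (8 * 9 ^ n) = V / 4 := by
    rw [show 2 * (9 : ℝ≥0∞) ^ n * V = (2 * 9 ^ n) * V by ring,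
      show (8 : ℝ≥0∞) * 9 ^ n = (2 * 9 ^ n) * 4 by ring,
      ENNReal.mul_div_mul_left _ _ (mul_ne_zero (by norm_num) h9)
        (ENNReal.mul_ne_top (by norm_num) h9')]
  rw [h3] at h2
  refine (measure_mono hsub).trans ((measure_union_le _ _).trans ((add_le_add h1 h2).trans ?_))
  rw [← ENNReal.add_div, ← two_mul, show (4 : ℝ≥0∞) = 2 * 2 by norm_num,
    ENNReal.mul_div_mul_left _ _ (by norm_num) (by norm_num)]

open Classical in
/-- The shifted operator, cut at scale `N`. -/
def shiftOp (G : Gr n) (S : SparseFamily n) (f : Fin m → (Fin n → ℝ) → ℝ) (L : ℕ) (N : ℤ)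
    (x : Fin n → ℝ) : ℝ≥0∞ :=
  ∑' s : ℤ, if s + L ≤ N ∧ mark G S s x then ∏ i, cubeAvg (G.q (s + L) x) (f i) else 0

/-- The scale `s` is assigned to the generation `j`. -/
def Asg (B : ℤ → ℤ → (Fin n → ℝ) → Prop) (N : ℤ) (L : ℕ) (x : Fin n → ℝ) (s : ℤ) (j : ℕ) : Prop :=
  ∃ t, Stop B N j t x ∧ s + L ≤ t ∧ (s + L = t ∨ ¬ B t (s + L) x)

open Classical in
lemma count_le (G : Gr n) (S : SparseFamily n) (f : Fin m → (Fin n → ℝ) → ℝ) (A K : ℝ≥0∞) (L : ℕ)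
    (hL : 0 < L) (N : ℤ) (x : Fin n → ℝ) (j : ℕ) :
    ∑' s : ℤ, (if mark G S s x ∧ Asg (stB G S f A K L) N L x s j then (1 : ℝ≥0∞) else 0) ≤
      K + L := by
  rw [ENNReal.tsum_eq_iSup_sum]
  refine iSup_le fun F => ?_
  rw [← Finset.sum_filter]
  set F' := F.filter fun s => mark G S s x ∧ Asg (stB G S f A K L) N L x s j with hF'
  rcases F'.eq_empty_or_nonempty with h | h
  · simp [h]
  set s₀ := F'.min' h with hs₀
  have hs₀m : s₀ ∈ F' := F'.min'_mem h
  obtain ⟨-, -, t, ht, hst, hor⟩ := (Finset.mem_filter.1 hs₀m)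
  have hall : ∀ s ∈ F', s₀ ≤ s ∧ s + L ≤ t ∧ mark G S s x := by
    intro s hs
    obtain ⟨-, hmk, t', ht', hst', -⟩ := (Finset.mem_filter.1 hs)
    obtain rfl := Stop_unique ht ht'
    exact ⟨F'.min'_le s hs, hst', hmk⟩
  rw [← Finset.sum_filter_add_sum_filter_not F' (fun s => s₀ + L ≤ s)]
  refine add_le_add ?_ ?_
  · rcases hor with hor | hor
    · have : F'.filter (fun s => s₀ + L ≤ s) = ∅ := by
        refine Finset.filter_eq_empty_iff.2 fun s hs hh => ?_
        have := hall s hs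
        omega
      rw [this]
      simp
    · have hc : cnt G S L t (s₀ + L) x ≤ K := by
        by_contra hcon
        exact hor (Or.inr (not_le.1 hcon))
      refine le_trans ?_ hc
      unfold cnt
      refine le_trans ?_ (ENNReal.sum_le_tsum (F'.filter fun s => s₀ + L ≤ s))
      refine Finset.sum_le_sum fun s hs => ?_
      rw [Finset.mem_filter] at hs
      have := hall s hs.1
      rw [if_pos ⟨hs.2, this.2⟩]
  · rw [Finset.sum_const, nsmul_eq_mul, mul_one]
    have : (F'.filter fun s => ¬ s₀ + L ≤ s).card ≤ L := by
      calc _ ≤ (Finset.Ico s₀ (s₀ + L)).card := by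
            refine Finset.card_le_card fun s hs => ?_
            rw [Finset.mem_filter] at hs
            have := hall s hs.1
            rw [Finset.mem_Ico]
            omega
        _ = L := by simp
    exact_mod_cast this

lemma pointwise (hn : n ≠ 0) (G : Gr n) (S : SparseFamily n) (f : Fin m → (Fin n → ℝ) → ℝ)
    (A K : ℝ≥0∞) (hA : 1 ≤ A) (L : ℕ) (hL : 0 < L)
    (hmeas : ∀ t x, volume {y | y ∈ (G.q t x).toSet ∧ ∃ k < t, stB G S f A K L t k y} ≤
      volume (G.q t x).toSet / 2)
    (N : ℤ) (v x : Fin n → ℝ) (hx : x ∈ (G.q N v).toSet) :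
    shiftOp G S f L N x ≤ (K + L) * A ^ m *
      sparseOp (stopFamily hn G (stB G S f A K L) stB_inv hmeas N v) f x := by
  classical
  set S' := stopFamily hn G (stB G S f A K L) stB_inv hmeas N v with hS'
  set c : ℤ → ℝ≥0∞ := fun j => ∑' Q : S'.cubes j,
    Q.1.toSet.indicator (fun _ => ∏ i, cubeAvg Q.1 (f i)) x with hc
  have hcj : ∀ (j : ℕ) t, Stop (stB G S f A K L) N j t x →
      ∏ i, cubeAvg (G.q t x) (f i) ≤ c j := by
    intro j t ht
    have hmem : G.q t x ∈ S'.cubes j := ⟨x, t, hx, ht, rfl⟩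
    refine le_trans ?_ (ENNReal.le_tsum (⟨G.q t x, hmem⟩ : S'.cubes j))
    rw [Set.indicator_of_mem (G.mem_q t x)]
  have h1 : shiftOp G S f L N x ≤ ∑' s : ℤ, ∑' j : ℕ,
      (if mark G S s x ∧ Asg (stB G S f A K L) N L x s j then (1 : ℝ≥0∞) else 0) *
        (A ^ m * c j) := by
    refine ENNReal.tsum_le_tsum fun s => ?_
    split_ifs with hs
    · obtain ⟨j, t, ht, hst, hor⟩ := exists_asg (B := stB G S f A K L) x (s + L) hs.1
      refine le_trans ?_ (ENNReal.le_tsum j)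
      rw [if_pos ⟨hs.2, t, ht, hst, hor⟩, one_mul]
      refine le_trans ?_ (mul_le_mul_right (hcj j t ht) _)
      have hA' : A ^ m = ∏ _i : Fin m, A := by simp
      rw [hA', ← Finset.prod_mul_distrib]
      refine Finset.prod_le_prod' fun i _ => ?_
      rcases hor with h | h
      · rw [h]
        exact le_mul_of_one_le_left zero_le hA
      · by_contra hcon
        exact h (Or.inl ⟨i, not_le.1 hcon⟩)
    · exact zero_le
  refine h1.trans ?_
  rw [ENNReal.tsum_comm]
  calc _ = ∑' j : ℕ, (∑' s : ℤ,
        if mark G S s x ∧ Asg (stB G S f A K L) N L x s j then (1 : ℝ≥0∞) else 0) *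
        (A ^ m * c j) := by
        refine tsum_congr fun j => ?_
        rw [ENNReal.tsum_mul_right]
    _ ≤ ∑' j : ℕ, (K + L) * (A ^ m * c j) := by
        refine ENNReal.tsum_le_tsum fun j => ?_
        gcongr
        exact count_le G S f A K L hL N x j
    _ = (K + L) * A ^ m * ∑' j : ℕ, c j := by
        rw [ENNReal.tsum_mul_left, ENNReal.tsum_mul_left, mul_assoc]
    _ ≤ (K + L) * A ^ m * ∑' j : ℤ, c j := by
        gcongr
        exact ENNReal.tsum_comp_le_tsum_of_injective (Nat.cast_injective (R := ℤ)) c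

/-- The norm bound for a shifted operator on an exhausted region. -/
lemma norm_shift (hn : n ≠ 0) (hm : 0 < m) (G : Gr n) (S : SparseFamily n)
    (f : Fin m → (Fin n → ℝ) → ℝ) (hf : ∀ i, Integrable (f i)) (L : ℕ) (hL : 0 < L)
    (X : BFunctionSpace n) (M : ℝ≥0∞)
    (hM : ∀ S' : SparseFamily n, (∀ k, S'.cubes k ⊆ G.D) → X.ρ (sparseOp S' f) ≤ M)
    (v : Fin n → ℝ) :
    X.ρ (fun x => ⨆ N : ℕ, (G.q N v).toSet.indicator (shiftOp G S f L N) x) ≤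
      (8 * 9 ^ n + L) * (4 * m) ^ m * M := by
  classical
  rw [X.fatou]
  · refine iSup_le fun N => ?_
    have hmeas := stB_meas hm G S f L hf
    set S' := stopFamily hn G (stB G S f (4 * m) (8 * 9 ^ n) L) stB_inv hmeas N v with hS'
    set C : ℝ≥0∞ := (8 * 9 ^ n + L) * (4 * m) ^ m with hC
    have hCt : C ≠ ∞ := by
      refine ENNReal.mul_ne_top (ENNReal.add_ne_top.2 ⟨?_, ENNReal.natCast_ne_top L⟩)
        (ENNReal.pow_ne_top (ENNReal.mul_ne_top (by norm_num) (ENNReal.natCast_ne_top m)))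
      exact ENNReal.mul_ne_top (by norm_num) (ENNReal.pow_ne_top (by norm_num))
    have hm1 : (1 : ℝ≥0∞) ≤ 4 * m := by
      have : 1 ≤ 4 * m := by omega
      exact_mod_cast this
    have hle : ∀ x, (G.q N v).toSet.indicator (shiftOp G S f L N) x ≤ C * sparseOp S' f x := by
      intro x
      by_cases hx : x ∈ (G.q N v).toSet
      · rw [Set.indicator_of_mem hx]
        exact pointwise hn G S f _ _ hm1 L hL hmeas N v x hx
      · rw [Set.indicator_of_notMem hx]
        exact zero_le
    refine (X.mono _ _ (ae_of_all _ hle)).trans ?_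
    have := X.smul_eq C.toNNReal (sparseOp S' f)
    rw [ENNReal.coe_toNNReal hCt] at this
    rw [this]
    gcongr
    refine hM S' ?_
    rintro k Q ⟨x, k', -, -, rfl⟩
    exact ⟨k', x, rfl⟩
  · intro k x
    by_cases hx : x ∈ (G.q (k : ℕ) v).toSet
    · have hx' : x ∈ (G.q ((k + 1 : ℕ) : ℤ) v).toSet := G.sub_q (by push_cast; omega) v hx
      rw [Set.indicator_of_mem hx, Set.indicator_of_mem hx']
      refine ENNReal.tsum_le_tsum fun s => ?_
      split_ifs with h1 h2 h2
      · exact le_rfl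
      · exact absurd ⟨by push_cast; omega, h1.2⟩ h2
      · exact zero_le
      · exact le_rfl
    · rw [Set.indicator_of_notMem hx]
      exact zero_le

open Classical in
lemma shift_sup (G : Gr n) (S : SparseFamily n) (f : Fin m → (Fin n → ℝ) → ℝ) (L : ℕ)
    (v x : Fin n → ℝ) (hx : ∃ N : ℕ, x ∈ (G.q N v).toSet) :
    ∑' s : ℤ, (if mark G S s x then ∏ i, cubeAvg (G.q (s + L) x) (f i) else 0) ≤
      ⨆ N : ℕ, (G.q N v).toSet.indicator (shiftOp G S f L N) x := by
  obtain ⟨N₀, hN₀⟩ := hx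
  rw [ENNReal.tsum_eq_iSup_sum]
  refine iSup_le fun F => ?_
  obtain ⟨b, hb⟩ := F.bddAbove
  set N : ℕ := max N₀ (b + L).toNat with hN
  refine le_trans ?_ (le_iSup _ N)
  have hxN : x ∈ (G.q N v).toSet := G.sub_q (by rw [hN]; push_cast; omega) v hN₀
  rw [Set.indicator_of_mem hxN]
  refine le_trans (Finset.sum_le_sum fun s hs => ?_) (ENNReal.sum_le_tsum F)
  have : s ≤ b := hb hs
  have h2 : s + L ≤ N := by rw [hN]; push_cast; omega
  simp [h2]

end domination

/-! ### The shifted grids -/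

section grids

/-- The shift of the grid at scale `2^k`. -/
def sg (b : Bool) (k : ℤ) : ℝ := if b then (-1) ^ k / 3 else 0

/-- The index of the interval of side `2^k` containing `y`. -/
def ix (b : Bool) (k : ℤ) (y : ℝ) : ℤ := ⌊y / 2 ^ k - sg b k⌋

lemma neg_one_zpow_cases (k : ℤ) : ((-1 : ℝ) ^ k = 1) ∨ ((-1 : ℝ) ^ k = -1) := by
  rcases Int.even_or_odd k with h | h
  · exact Or.inl h.neg_one_zpow
  · exact Or.inr h.neg_one_zpow

lemma sg_succ (b : Bool) (k : ℤ) : sg b (k + 1) = - sg b k := by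
  unfold sg
  split_ifs
  · rw [zpow_add_one₀ (by norm_num)]; ring
  · simp

lemma three_sg (b : Bool) (k : ℤ) : ∃ e : ℤ, 3 * sg b k = e := by
  unfold sg
  split_ifs
  · rcases neg_one_zpow_cases k with h | h
    · exact ⟨1, by rw [h]; norm_num⟩
    · exact ⟨-1, by rw [h]; norm_num⟩
  · exact ⟨0, by norm_num⟩

lemma ix_succ (b : Bool) (k : ℤ) (y : ℝ) :
    ∃ e : ℤ, 3 * sg b k = e ∧ ix b (k + 1) y = (ix b k y + e) / 2 := by
  obtain ⟨e, he⟩ := three_sg b k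
  refine ⟨e, he, ?_⟩
  unfold ix
  have h1 : y / 2 ^ (k + 1) - sg b (k + 1) = (y / 2 ^ k - sg b k + e) / 2 := by
    rw [sg_succ, ← he, zpow_add_one₀ (by norm_num)]
    have : (2 : ℝ) ^ k ≠ 0 := by positivity
    field_simp
    ring
  rw [h1, ← Int.floor_add_intCast]
  exact_mod_cast Int.floor_div_natCast (y / 2 ^ k - sg b k + (e : ℝ)) 2

lemma ix_succ_eq {b : Bool} {k : ℤ} {x y : ℝ} (h : ix b k y = ix b k x) :
    ix b (k + 1) y = ix b (k + 1) x := by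
  obtain ⟨e, he, h1⟩ := ix_succ b k y
  obtain ⟨e', he', h2⟩ := ix_succ b k x
  have : e = e' := by exact_mod_cast he.symm.trans he'
  rw [h1, h2, h, this]

lemma ix_iff {b : Bool} {k : ℤ} {y : ℝ} {j : ℤ} :
    (2 : ℝ) ^ k * (j + sg b k) ≤ y ∧ y < 2 ^ k * (j + sg b k) + 2 ^ k ↔ ix b k y = j := by
  have h2 : (0 : ℝ) < 2 ^ k := by positivity
  unfold ix
  rw [Int.floor_eq_iff]
  refine and_congr ?_ ?_
  · rw [le_sub_iff_add_le, le_div_iff₀ h2, mul_comm]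
  · rw [sub_lt_iff_lt_add, div_lt_iff₀ h2]
    constructor <;> intro h <;> linarith

variable {n : ℕ}

/-- The grid cube with given index. -/
def gcube (a : Fin n → Bool) (k : ℤ) (j : Fin n → ℤ) : Cube n :=
  ⟨fun i => 2 ^ k * (j i + sg (a i) k), 2 ^ k, by positivity⟩

lemma mem_gcube {a : Fin n → Bool} {k : ℤ} {j : Fin n → ℤ} {y : Fin n → ℝ} :
    y ∈ (gcube a k j).toSet ↔ ∀ i, ix (a i) k (y i) = j i :=
  forall_congr' fun _ => ix_iff

/-- The shifted dyadic grids. -/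
def grid (a : Fin n → Bool) : Gr n where
  q k x := gcube a k fun i => ix (a i) k (x i)
  side_q _ _ := rfl
  mem_q k x := mem_gcube.2 fun _ => rfl
  eq_q k x y h := by
    rw [mem_gcube] at h
    simp only [h]
  sub_succ k x y h := by
    rw [mem_gcube] at h ⊢
    exact fun i => ix_succ_eq (h i)
  countable_q k := by
    refine (Set.countable_range (gcube a k)).mono ?_
    rintro _ ⟨x, rfl⟩
    exact ⟨_, rfl⟩

lemma mem_grid {a : Fin n → Bool} {k : ℤ} {x y : Fin n → ℝ} :
    y ∈ ((grid a).q k x).toSet ↔ ∀ i, ix (a i) k (y i) = ix (a i) k (x i) := mem_gcube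

/-- If two points have different index, there is a grid point between them. -/
lemma exists_between_pt {b : Bool} {k : ℤ} {u w x y : ℝ} (hx : u ≤ x ∧ x < u + w)
    (hy : u ≤ y ∧ y < u + w) (h : ix b k y ≠ ix b k x) :
    ∃ p : ℤ, u < 2 ^ k * (p + sg b k) ∧ 2 ^ k * (p + sg b k) < u + w := by
  have hx' := (ix_iff (b := b) (k := k) (y := x)).2 rfl
  have hy' := (ix_iff (b := b) (k := k) (y := y)).2 rfl
  have h2 : (0 : ℝ) < 2 ^ k := by positivity
  rcases lt_or_gt_of_ne h with h | h
  · refine ⟨ix b k x, ?_, by linarith⟩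
    have : (ix b k y : ℝ) + 1 ≤ ix b k x := by exact_mod_cast h
    have := mul_le_mul_of_nonneg_left this h2.le
    linarith
  · refine ⟨ix b k y, ?_, by linarith⟩
    have : (ix b k x : ℝ) + 1 ≤ ix b k y := by exact_mod_cast h
    have := mul_le_mul_of_nonneg_left this h2.le
    linarith

lemma third_trick (k : ℤ) (u w x : ℝ) (hw : w ≤ 2 ^ k / 3) (hx : u ≤ x ∧ x < u + w) :
    ∃ b : Bool, ∀ y, u ≤ y ∧ y < u + w → ix b k y = ix b k x := by
  by_contra hcon
  push Not at hcon
  obtain ⟨y, hy, hne⟩ := hcon false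
  obtain ⟨y', hy', hne'⟩ := hcon true
  obtain ⟨p, hp1, hp2⟩ := exists_between_pt hx hy hne
  obtain ⟨p', hp1', hp2'⟩ := exists_between_pt hx hy' hne'
  have h2 : (0 : ℝ) < 2 ^ k := by positivity
  have e1 : (2 : ℝ) ^ k * (3 * p - 3 * (p' + sg true k)) < 2 ^ k * 1 := by
    simp only [sg] at *
    simp at *
    linarith
  have e2 : (2 : ℝ) ^ k * (-1) < 2 ^ k * (3 * p - 3 * (p' + sg true k)) := by
    simp only [sg] at *
    simp at *
    linarith
  have e1 := lt_of_mul_lt_mul_left e1 h2.le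
  have e2 := lt_of_mul_lt_mul_left e2 h2.le
  rcases neg_one_zpow_cases k with h | h
  · simp only [sg, h, if_true] at e1 e2
    have e1 : (3 * p - 3 * p' - 1 : ℝ) < 1 := by linarith
    have e2 : (-1 : ℝ) < 3 * p - 3 * p' - 1 := by linarith
    have e1 : (3 * p - 3 * p' - 1 : ℤ) < 1 := by exact_mod_cast e1
    have e2 : (-1 : ℤ) < 3 * p - 3 * p' - 1 := by exact_mod_cast e2
    omega
  · simp only [sg, h, if_true] at e1 e2
    have e1 : (3 * p - 3 * p' + 1 : ℝ) < 1 := by linarith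
    have e2 : (-1 : ℝ) < 3 * p - 3 * p' + 1 := by linarith
    have e1 : (3 * p - 3 * p' + 1 : ℤ) < 1 := by exact_mod_cast e1
    have e2 : (-1 : ℤ) < 3 * p - 3 * p' + 1 := by exact_mod_cast e2
    omega

/-- The base points. -/
def vv (w : Fin n → Bool) : Fin n → ℝ := fun i => if w i then -1 else 0

lemma ix_near {b : Bool} {N : ℕ} {x y : ℝ} (hx : 3 * |x| < 2 ^ N) (hy : 3 * |y| < 2 ^ N)
    (hs : 0 ≤ x ↔ 0 ≤ y) : ix b N x = ix b N y := by
  have h2 : (0 : ℝ) < 2 ^ N := by positivity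
  have key : ∀ z : ℝ, 3 * |z| < 2 ^ N → -(1 / 3) < z / 2 ^ N ∧ z / 2 ^ N < 1 / 3 := by
    intro z hz
    have := abs_le.1 (le_refl |z|)
    rw [lt_div_iff₀ h2, div_lt_iff₀ h2]
    constructor <;> linarith
  have kx := key x hx
  have ky := key y hy
  unfold ix
  rw [zpow_natCast]
  have hsx : 0 ≤ x / 2 ^ N ↔ 0 ≤ y / 2 ^ N := by
    rw [le_div_iff₀ h2, le_div_iff₀ h2]; simpa using hs
  generalize x / 2 ^ N = X at *
  generalize y / 2 ^ N = Y at *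
  cases b with
  | false =>
    simp only [sg]
    by_cases h : 0 ≤ X
    · have h' := hsx.1 h
      have e1 : ⌊X - 0⌋ = 0 := by rw [Int.floor_eq_iff]; push_cast; constructor <;> linarith
      have e2 : ⌊Y - 0⌋ = 0 := by rw [Int.floor_eq_iff]; push_cast; constructor <;> linarith
      simpa using e1.trans e2.symm
    · have h' : ¬ 0 ≤ Y := fun h' => h (hsx.2 h')
      push Not at h h'
      have e1 : ⌊X - 0⌋ = -1 := by rw [Int.floor_eq_iff]; push_cast; constructor <;> linarith
      have e2 : ⌊Y - 0⌋ = -1 := by rw [Int.floor_eq_iff]; push_cast; constructor <;> linarith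
      simpa using e1.trans e2.symm
  | true =>
    simp only [sg, if_true]
    rcases neg_one_zpow_cases N with h | h
    · rw [h]
      have e1 : ⌊X - 1 / 3⌋ = -1 := by rw [Int.floor_eq_iff]; push_cast; constructor <;> linarith
      have e2 : ⌊Y - 1 / 3⌋ = -1 := by rw [Int.floor_eq_iff]; push_cast; constructor <;> linarith
      exact e1.trans e2.symm
    · rw [h]
      have e1 : ⌊X - -1 / 3⌋ = 0 := by rw [Int.floor_eq_iff]; push_cast; constructor <;> linarith
      have e2 : ⌊Y - -1 / 3⌋ = 0 := by rw [Int.floor_eq_iff]; push_cast; constructor <;> linarith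
      exact e1.trans e2.symm

lemma exhaust (a : Fin n → Bool) (x : Fin n → ℝ) :
    ∃ w : Fin n → Bool, ∃ N : ℕ, x ∈ ((grid a).q N (vv w)).toSet := by
  obtain ⟨N, hN⟩ := pow_unbounded_of_one_lt (3 * (‖x‖ + 1)) (one_lt_two (α := ℝ))
  refine ⟨fun i => decide (x i < 0), N, mem_grid.2 fun i => ix_near ?_ ?_ ?_⟩
  · have : |x i| ≤ ‖x‖ := norm_le_pi_norm x i
    linarith
  · have h0 : 0 ≤ ‖x‖ := norm_nonneg x
    simp only [vv]
    split_ifs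
    · rw [abs_neg, abs_one]; linarith
    · rw [abs_zero]; linarith
  · simp only [vv]
    by_cases h : x i < 0
    · have h2 : ¬ (0 ≤ x i) := not_le.2 h
      have h3 : ¬ ((1 : ℝ) ≤ 0) := by norm_num
      simp [h, h2, h3]
    · simp [h, not_lt.1 h]

end grids

/-! ### Final assembly -/

section final

variable {n m : ℕ}

lemma std_corner {Q : Cube n} (hQ : Q ∈ stdGrid n) {e : ℤ} (he : Q.side = 2 ^ e)
    {x : Fin n → ℝ} (hx : x ∈ Q.toSet) (i : Fin n) :
    Q.corner i = 2 ^ e * (⌊x i / 2 ^ e⌋ : ℝ) := by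
  obtain ⟨k, j, h1, h2⟩ := hQ
  have hk : k = e := two_zpow_inj (h1.symm.trans he)
  subst hk
  have hp : (0 : ℝ) < 2 ^ k := by positivity
  have h3 := hx i
  rw [h1, h2 i] at h3
  have h4 : ⌊x i / 2 ^ k⌋ = j i := by
    rw [Int.floor_eq_iff, le_div_iff₀ hp, div_lt_iff₀ hp]
    constructor <;> linarith [h3.1, h3.2]
  rw [h4, h2 i]

lemma toSet_congr {Q R : Cube n} (h1 : Q.side = R.side) (h2 : ∀ i, Q.corner i = R.corner i) :
    Q.toSet = R.toSet := by
  ext y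
  simp only [Cube.toSet, Set.mem_ofPred_eq, h1, h2]

lemma side_inj {S : SparseFamily n} (hS : ∀ k, S.cubes k ⊆ stdGrid n) {p p' : Idx S}
    {e : ℤ} (hp : (cb p).side = 2 ^ e) (hp' : (cb p').side = 2 ^ e) {x : Fin n → ℝ}
    (hx : x ∈ (cb p).toSet) (hx' : x ∈ (cb p').toSet) : p = p' := by
  have hc : (cb p).toSet = (cb p').toSet :=
    toSet_congr (hp.trans hp'.symm) fun i => by
      exact (std_corner (hS _ p.2.2) hp hx i).trans (std_corner (hS _ p'.2.2) hp' hx' i).symm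
  rcases lt_trichotomy p.1 p'.1 with h | h | h
  · exact (cb_ne h hc).elim
  · obtain ⟨k, Q, hQ⟩ := p
    obtain ⟨k', Q', hQ'⟩ := p'
    simp only at h
    subst h
    have : Q = Q' := by
      by_contra hne
      exact Set.disjoint_left.1 (S.pairwiseDisjoint k hQ hQ' hne) hx hx'
    subst this
    rfl
  · exact (cb_ne h hc.symm).elim

lemma cubeAvg_le {Q R : Cube n} (h : Q.toSet ⊆ R.toSet) (hs : R.side = 4 * Q.side)
    (f : (Fin n → ℝ) → ℝ) : cubeAvg Q f ≤ 4 ^ n * cubeAvg R f := by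
  unfold cubeAvg
  have hv : volume R.toSet = 4 ^ n * volume Q.toSet := by
    rw [volume_toSet, volume_toSet, hs, ENNReal.ofReal_mul (by norm_num), mul_pow]
    norm_num
  have h4 : (4 : ℝ≥0∞) ^ n ≠ 0 := by positivity
  have h4' : (4 : ℝ≥0∞) ^ n ≠ ∞ := ENNReal.pow_ne_top (by norm_num)
  rw [hv, ← mul_div_assoc, ENNReal.mul_div_mul_left _ _ h4 h4']
  exact ENNReal.div_le_div_right (lintegral_mono_set h) _

open Classical in
lemma dil_pointwise (S : SparseFamily n) (hS : ∀ k, S.cubes k ⊆ stdGrid n) (l : ℕ)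
    (f : Fin m → (Fin n → ℝ) → ℝ) (x : Fin n → ℝ) :
    sparseOpDil S l f x ≤ 4 ^ (n * m) * ∑ a : Fin n → Bool,
      ∑' s : ℤ, (if mark (grid a) S s x then
        ∏ i, cubeAvg ((grid a).q (s + (l + 2 : ℕ)) x) (f i) else 0) := by
  have hex : ∀ p : Idx S, ∃ e : ℤ, (cb p).side = 2 ^ e := fun p => by
    obtain ⟨k, _, h, _⟩ := hS _ p.2.2
    exact ⟨k, h⟩
  choose e he using hex
  set F : ℤ → ℝ≥0∞ := fun s => 4 ^ (n * m) * ∑ a : Fin n → Bool,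
      (if mark (grid a) S s x then
        ∏ i, cubeAvg ((grid a).q (s + (l + 2 : ℕ)) x) (f i) else 0) with hF
  have hRHS : 4 ^ (n * m) * ∑ a : Fin n → Bool,
      ∑' s : ℤ, (if mark (grid a) S s x then
        ∏ i, cubeAvg ((grid a).q (s + (l + 2 : ℕ)) x) (f i) else 0) = ∑' s, F s := by
    rw [hF, ENNReal.tsum_mul_left, Summable.tsum_finsetSum fun _ _ => ENNReal.summable]
  rw [hRHS]
  set T : Idx S → ℝ≥0∞ := fun p => ∏ i, cubeAvg ((cb p).dilate ((2 : ℝ) ^ l) (by positivity)) (f i)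
    with hT
  have hL : sparseOpDil S l f x = ∑' p : {p : Idx S | x ∈ (cb p).toSet}, T p := by
    rw [tsum_subtype]
    unfold sparseOpDil
    rw [← ENNReal.tsum_sigma]
    rfl
  rw [hL]
  have hinj : Function.Injective (fun p : {p : Idx S | x ∈ (cb p).toSet} => e p.1) := by
    intro p p' h
    simp only at h
    exact Subtype.ext (side_inj hS (he p.1) (by rw [h]; exact he p'.1) p.2 p'.2)
  refine le_trans (ENNReal.tsum_le_tsum fun p => ?_) (ENNReal.tsum_comp_le_tsum_of_injective hinj F)
  obtain ⟨p, hx⟩ := p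
  simp only [hF]
  have hx : x ∈ (cb p).toSet := hx
  set Q := (cb p).dilate ((2 : ℝ) ^ l) (by positivity) with hQ
  have hs : Q.side = 2 ^ l * 2 ^ (e p) := by rw [hQ, Cube.dilate]; simp only [he]
  have h2l : (1 : ℝ) ≤ 2 ^ l := one_le_pow₀ (by norm_num)
  have hxQ : x ∈ Q.toSet := by
    intro i
    have h := hx i
    have hp := (cb p).side_pos
    simp only [hQ, Cube.dilate]
    constructor <;> nlinarith [h.1, h.2]
  have hpow : (2 : ℝ) ^ (e p + ((l + 2 : ℕ) : ℤ)) = 4 * Q.side := by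
    rw [hs, zpow_add₀ (by norm_num), zpow_natCast, pow_add]; ring
  have hw : Q.side ≤ 2 ^ (e p + ((l + 2 : ℕ) : ℤ)) / 3 := by
    rw [hpow]; linarith [Q.side_pos]
  choose a ha using fun i => third_trick (e p + ((l + 2 : ℕ) : ℤ)) (Q.corner i) Q.side (x i) hw (hxQ i)
  have hsub : Q.toSet ⊆ ((grid a).q (e p + ((l + 2 : ℕ) : ℤ)) x).toSet := fun y hy =>
    mem_grid.2 fun i => ha i (y i) (hy i)
  have hmark : mark (grid a) S (e p) x := ⟨p, he p, x, hx, (grid a).mem_q _ _⟩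
  have hterm : T p ≤ 4 ^ (n * m) * ∏ i, cubeAvg ((grid a).q (e p + (l + 2 : ℕ)) x) (f i) := by
    calc T p ≤ ∏ i : Fin m, (4 ^ n * cubeAvg ((grid a).q (e p + (l + 2 : ℕ)) x) (f i)) :=
          Finset.prod_le_prod' fun i _ =>
            cubeAvg_le hsub (((grid a).side_q _ _).trans hpow) (f i)
      _ = _ := by
          rw [Finset.prod_mul_distrib, Finset.prod_const, Finset.card_univ, Fintype.card_fin,
            ← pow_mul]
  refine hterm.trans ?_
  gcongr
  refine le_trans ?_ (Finset.single_le_sum (fun _ _ => zero_le) (Finset.mem_univ a))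
  rw [if_pos hmark]

lemma rho_zero (X : BFunctionSpace n) : X.ρ (fun _ => 0) = 0 :=
  (X.eq_zero_iff _).2 (Filter.EventuallyEq.rfl)

lemma rho_sum_le (X : BFunctionSpace n) {ι : Type*} (s : Finset ι)
    (g : ι → (Fin n → ℝ) → ℝ≥0∞) (B : ℝ≥0∞) (hB : ∀ a ∈ s, X.ρ (g a) ≤ B) :
    X.ρ (fun x => ∑ a ∈ s, g a x) ≤ s.card * B := by
  classical
  induction s using Finset.induction_on with
  | empty => simp [rho_zero]
  | insert a s ha ih =>
    simp only [Finset.sum_insert ha]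
    refine (X.add_le _ _).trans ?_
    rw [Finset.card_insert_of_notMem ha, Nat.cast_add, Nat.cast_one, add_mul, one_mul, add_comm]
    exact add_le_add (ih fun b hb => hB b (Finset.mem_insert_of_mem hb))
      (hB a (Finset.mem_insert_self a s))

lemma idx_empty (S : SparseFamily 0) (p : Idx S) : False := by
  obtain ⟨k, Q, hQ⟩ := p
  have hx : (0 : Fin 0 → ℝ) ∈ ⋃ R ∈ S.cubes (k - 1 + 1), R.toSet := by
    rw [sub_add_cancel]
    exact mem_biUnion hQ fun i => i.elim0
  have h := S.nested (k - 1) hx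
  simp only [mem_iUnion] at h
  obtain ⟨R, hR, _⟩ := h
  refine cb_ne (p := (⟨k - 1, R, hR⟩ : Idx S)) (p' := ⟨k, Q, hQ⟩) (by simp) ?_
  ext y
  exact ⟨fun _ i => i.elim0, fun _ i => i.elim0⟩

theorem final_bound (hm : 0 < m) (l : ℕ) (X : BFunctionSpace n)
    (f : Fin m → (Fin n → ℝ) → ℝ) (hf : ∀ i, Integrable (f i))
    (S : SparseFamily n) (hS : ∀ k, S.cubes k ⊆ stdGrid n) (M : ℝ≥0∞)
    (hM : ∀ D : Set (Cube n), IsDyadicGrid D → ∀ S' : SparseFamily n,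
      (∀ k, S'.cubes k ⊆ D) → X.ρ (sparseOp S' f) ≤ M) :
    X.ρ (sparseOpDil S l f) ≤
      4 ^ (n * m) * (2 ^ n * (2 ^ n * ((8 * 9 ^ n + (l + 2 : ℕ)) * (4 * m) ^ m * M))) := by
  classical
  rcases Nat.eq_zero_or_pos n with rfl | hn
  · have : sparseOpDil S l f = fun _ => 0 := by
      funext x
      unfold sparseOpDil
      refine ENNReal.tsum_eq_zero.2 fun k => ENNReal.tsum_eq_zero.2 fun Q => ?_
      exact (idx_empty S ⟨k, Q⟩).elim
    rw [this, rho_zero]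
    exact zero_le
  · set B : ℝ≥0∞ := (8 * 9 ^ n + (l + 2 : ℕ)) * (4 * m) ^ m * M with hB
    set g : (Fin n → Bool) → (Fin n → Bool) → (Fin n → ℝ) → ℝ≥0∞ := fun a w x =>
      ⨆ N : ℕ, ((grid a).q N (vv w)).toSet.indicator (shiftOp (grid a) S f (l + 2) N) x with hg
    have hgB : ∀ a w, X.ρ (g a w) ≤ B := fun a w =>
      norm_shift hn.ne' hm (grid a) S f hf (l + 2) (by omega) X M
        (fun S' hS' => hM _ (grid a).isDyadicGrid S' hS') (vv w)
    have hcard : (Finset.univ : Finset (Fin n → Bool)).card = 2 ^ n := by simp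
    have hsum : X.ρ (fun x => ∑ a, ∑ w, g a w x) ≤ 2 ^ n * (2 ^ n * B) := by
      have := rho_sum_le X Finset.univ (fun a x => ∑ w, g a w x) (2 ^ n * B) (fun a _ => by
        have := rho_sum_le X Finset.univ (g a) B (fun w _ => hgB a w)
        rw [hcard] at this
        exact_mod_cast this)
      rw [hcard] at this
      exact_mod_cast this
    have hpt : ∀ x, sparseOpDil S l f x ≤ ((4 ^ (n * m) : ℝ≥0) : ℝ≥0∞) * ∑ a, ∑ w, g a w x := by
      intro x
      refine (dil_pointwise S hS l f x).trans ?_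
      push_cast
      gcongr with a
      obtain ⟨w, hw⟩ := exhaust a x
      refine le_trans (shift_sup (grid a) S f (l + 2) (vv w) x hw) ?_
      exact Finset.single_le_sum (f := fun w => g a w x) (fun _ _ => zero_le) (Finset.mem_univ w)
    calc X.ρ (sparseOpDil S l f)
        ≤ X.ρ (fun x => ((4 ^ (n * m) : ℝ≥0) : ℝ≥0∞) * ∑ a, ∑ w, g a w x) :=
          X.mono _ _ (Filter.Eventually.of_forall hpt)
      _ = ((4 ^ (n * m) : ℝ≥0) : ℝ≥0∞) * X.ρ (fun x => ∑ a, ∑ w, g a w x) := X.smul_eq _ _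
      _ ≤ ((4 ^ (n * m) : ℝ≥0) : ℝ≥0∞) * (2 ^ n * (2 ^ n * B)) := by gcongr
      _ = _ := by push_cast; rfl

end final

end DSD
/-- estimate (4.4): dilated sparse operators are dominated in norm by
sparse operators: `sup_𝒮 ‖𝒯_{𝒮,l}(f⃗)‖_X ≤ c(l+1) sup_{𝒟,𝒮} ‖𝒜_{𝒟,𝒮}(f⃗)‖_X`,
with `c = c(m,n)`. -/
theorem dilated_sparse_dominated (n m : ℕ) (hm : 0 < m) :
    ∃ c : ℝ, 0 < c ∧
      ∀ (l : ℕ) (X : BFunctionSpace n) (f : Fin m → (Fin n → ℝ) → ℝ),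
        (∀ i, Measurable (f i)) → (∀ i x, 0 ≤ f i x) → (∀ i, Integrable (f i)) →
        (⨆ (S : SparseFamily n) (_ : ∀ k, S.cubes k ⊆ stdGrid n),
            X.ρ (sparseOpDil S l f)) ≤
          ENNReal.ofReal (c * (l + 1)) *
            ⨆ (D : Set (Cube n)) (_ : IsDyadicGrid D) (S : SparseFamily n)
              (_ : ∀ k, S.cubes k ⊆ D), X.ρ (sparseOp S f) := by
  set cN : ℕ := 4 ^ (n * m) * (2 ^ n * (2 ^ n * ((8 * 9 ^ n + 2) * (4 * m) ^ m))) with hc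
  refine ⟨(cN : ℝ), ?_, ?_⟩
  · have : 0 < cN := by rw [hc]; positivity
    exact_mod_cast this
  intro l X f _ _ hf
  refine iSup₂_le fun S hS => ?_
  refine (DSD.final_bound hm l X f hf S hS _ (fun D hD S' hS' =>
    le_iSup_of_le D (le_iSup_of_le hD (le_iSup₂_of_le S' hS' le_rfl)))).trans ?_
  generalize (⨆ (D : Set (Cube n)) (_ : IsDyadicGrid D) (S : SparseFamily n)
              (_ : ∀ k, S.cubes k ⊆ D), X.ρ (sparseOp S f)) = M
  have h1 : ENNReal.ofReal ((cN : ℝ) * ((l : ℝ) + 1)) = ((cN * (l + 1) : ℕ) : ℝ≥0∞) := by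
    rw [← ENNReal.ofReal_natCast]
    push_cast
    rfl
  have h2 : 4 ^ (n * m) * (2 ^ n * (2 ^ n * ((8 * 9 ^ n + (l + 2)) * (4 * m) ^ m)))
      ≤ cN * (l + 1) := by
    have h3 : 8 * 9 ^ n + (l + 2) ≤ (8 * 9 ^ n + 2) * (l + 1) := by
      nlinarith [Nat.zero_le (9 ^ n * l)]
    calc _ ≤ 4 ^ (n * m) * (2 ^ n * (2 ^ n * (((8 * 9 ^ n + 2) * (l + 1)) * (4 * m) ^ m))) := by
          gcongr
      _ = _ := by rw [hc]; ring
  have h4 : ((4 ^ (n * m) * (2 ^ n * (2 ^ n * ((8 * 9 ^ n + (l + 2)) * (4 * m) ^ m))) : ℕ) : ℝ≥0∞)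
      ≤ ((cN * (l + 1) : ℕ) : ℝ≥0∞) := Nat.cast_le.2 h2
  rw [h1]
  refine le_trans (le_of_eq ?_) (mul_le_mul_left h4 M)
  push_cast
  ring
end
end
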